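/- Let p ≥ 3, h = 0 and β > β*(p), and let m_* be the unique positive global maximizer of H_{β,0,p}. Let β̂ be the maximum pseudolikelihood estimate of β given X ~ P_{β,0,p}. Then there exists a constant C > 0 such that for all N ≥ 2, sup_{x ∈ ℝ} | P( √N(β̂ − β) ≤ x ) − P( Z ≤ x ) | ≤ C·(log N)/√N, where Z is a centered Gaussian random variable with variance −H''_{β,0,p}(m_*)/(p² m_*^{2p−2}). -/

import Mathlib

open Real MeasureTheory Filter
open scoped BigOperators Topology

noncomputable section

/-- The spin value (`±1`) of a Boolean coordinate. -/
def spin (b : Bool) : ℝ := if b then 1 else -1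

/-- The total magnetization `S_N = ∑ᵢ Xᵢ` of a configuration. -/
def mag {N : ℕ} (x : Fin N → Bool) : ℝ := ∑ i, spin (x i)

/-- The Hamiltonian of the `p`-spin Curie-Weiss model:
`β N^{1-p} ∑_{i₁,…,i_p} x_{i₁} ⋯ x_{i_p} + h ∑ᵢ xᵢ`. -/
def cwHamiltonian (p N : ℕ) (β h : ℝ) (x : Fin N → Bool) : ℝ :=
  β * (N : ℝ) ^ ((1 : ℤ) - (p : ℤ)) * (∑ i : Fin p → Fin N, ∏ j, spin (x (i j)))
    + h * mag x

/-- The (unnormalized) Gibbs weight of a configuration. -/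
def cwWeight (p N : ℕ) (β h : ℝ) (x : Fin N → Bool) : ℝ :=
  Real.exp (cwHamiltonian p N β h x)

/-- The probability of an event `E` under the `p`-spin Curie-Weiss measure `P_{β,h,p}`. -/
def cwProb (p N : ℕ) (β h : ℝ) (E : Set (Fin N → Bool)) : ℝ :=
  (∑ x : Fin N → Bool, E.indicator (cwWeight p N β h) x) /
    ∑ x : Fin N → Bool, cwWeight p N β h x

/-- Conditional probability of `E` given `A` under the `p`-spin Curie-Weiss measure. -/
def cwCondProb (p N : ℕ) (β h : ℝ) (E A : Set (Fin N → Bool)) : ℝ :=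
  cwProb p N β h (E ∩ A) / cwProb p N β h A

/-- The binary entropy function `I(x) = ½[(1+x)log(1+x) + (1-x)log(1-x)]`. -/
def binEnt (x : ℝ) : ℝ := (1/2) * ((1+x) * Real.log (1+x) + (1-x) * Real.log (1-x))

/-- The function `H_{β,h,p}(x) = βxᵖ + hx - I(x)`. -/
def Hfun (p : ℕ) (β h : ℝ) (x : ℝ) : ℝ := β * x ^ p + h * x - binEnt x

/-- `m` is a global maximizer of `H_{β,h,p}` on `[-1,1]`, lying in `(-1,1)`. -/
def isMaximizer (p : ℕ) (β h m : ℝ) : Prop :=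
  m ∈ Set.Ioo (-1 : ℝ) 1 ∧ ∀ x ∈ Set.Icc (-1 : ℝ) 1, Hfun p β h x ≤ Hfun p β h m

/-- `m` is the unique global maximizer of `H_{β,h,p}`. -/
def isUniqueMaximizer (p : ℕ) (β h m : ℝ) : Prop :=
  isMaximizer p β h m ∧ ∀ m', isMaximizer p β h m' → m' = m

/-- `(β,h)` is a `p`-regular point with unique global maximizer `m`. -/
def pRegular (p : ℕ) (β h m : ℝ) : Prop :=
  isUniqueMaximizer p β h m ∧ iteratedDeriv 2 (Hfun p β h) m < 0

/-- `(β,h)` is a `p`-special point with unique global maximizer `m`. -/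
def pSpecial (p : ℕ) (β h m : ℝ) : Prop :=
  isUniqueMaximizer p β h m ∧ iteratedDeriv 2 (Hfun p β h) m = 0

/-- `(β,h)` is a `p`-critical point: `H_{β,h,p}` has more than one global maximizer. -/
def pCritical (p : ℕ) (β h : ℝ) : Prop :=
  ∃ m₁ m₂, m₁ ≠ m₂ ∧ isMaximizer p β h m₁ ∧ isMaximizer p β h m₂

/-- The probability assigned to a set `S ⊆ ℝ` by the centered Gaussian with variance `v`. -/
def gaussProb (v : ℝ) (S : Set ℝ) : ℝ :=
  ∫ t in S, (Real.sqrt (2 * Real.pi * v))⁻¹ * Real.exp (-t ^ 2 / (2 * v))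

/-- The CDF of the centered Gaussian with variance `v`. -/
def gaussCDF (v x : ℝ) : ℝ := gaussProb v (Set.Iic x)

/-- The standard normal CDF `Φ`. -/
def stdNormCDF (x : ℝ) : ℝ := gaussCDF 1 x

/-- The CDF of the limit law `F` at a `p`-special point, where `c = H⁽⁴⁾(m_*)`:
`dF(x) = (2/Γ(1/4)) (-c/24)^{1/4} exp(c x⁴/24) dx`. -/
def specialCDF (c x : ℝ) : ℝ :=
  ∫ t in Set.Iic x, (2 / Real.Gamma (1/4)) * ((-c) / 24) ^ ((1:ℝ)/4) * Real.exp (c * t ^ 4 / 24)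

/-- The inverse hyperbolic tangent `tanh⁻¹(t) = ½ log((1+t)/(1-t))`. -/
def arctanh (t : ℝ) : ℝ := (1/2) * Real.log ((1+t)/(1-t))

/-- The function `g(t) = tanh⁻¹(t)/(p t^{p-1})`, so that the maximum pseudolikelihood
estimate of `β` is `g(X̄)`. -/
def gMPL (p : ℕ) (t : ℝ) : ℝ := arctanh t / (p * t ^ (p - 1))

/-- The threshold `β*(p) = inf{β ≥ 0 : sup_{x∈[0,1]} H_{β,0,p}(x) > 0}`. -/
def betaStar (p : ℕ) : ℝ := sInf {b : ℝ | 0 ≤ b ∧ ∃ x ∈ Set.Icc (0:ℝ) 1, 0 < Hfun p b 0 x}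

lemma sum_mag (N : ℕ) (φ : ℝ → ℝ) :
    ∑ σ : Fin N → Bool, φ (mag σ) =
      ∑ k ∈ Finset.range (N + 1), (N.choose k : ℝ) * φ (2 * k - N) := by
  have h1 : ∑ σ : Fin N → Bool, φ (mag σ) =
      ∑ s ∈ (Finset.univ : Finset (Fin N)).powerset, φ (2 * (s.card : ℝ) - N) := by
    refine Finset.sum_nbij' (fun σ => Finset.univ.filter (fun i => σ i = true))
      (fun s i => decide (i ∈ s)) ?_ ?_ ?_ ?_ ?_
    · simp
    · simp
    · intro σ _; ext i; simp
    · intro s _; ext i; simp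
    · intro σ _
      congr 1
      have h2 : ∀ i, spin (σ i) = 2 * (if σ i = true then (1 : ℝ) else 0) - 1 := by
        intro i; unfold spin; split_ifs <;> norm_num
      unfold mag
      simp_rw [h2, Finset.sum_sub_distrib, ← Finset.mul_sum, Finset.sum_boole]
      simp
  rw [h1, Finset.sum_powerset_apply_card (fun k => φ (2 * (k : ℝ) - N))]
  simp

/-- The magnetization per site of a configuration with `k` positive spins among `N`. -/
def site (N k : ℕ) : ℝ := 2 * (k : ℝ) / N - 1

/-- The total Gibbs weight of the configurations with `k` positive spins. -/
def levelWeight (p N : ℕ) (β : ℝ) (k : ℕ) : ℝ :=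
  (N.choose k : ℝ) * Real.exp (N * (β * site N k ^ p))

lemma cwWeight_eq (p N : ℕ) (hN : 1 ≤ N) (β : ℝ) (σ : Fin N → Bool) :
    cwWeight p N β 0 σ = Real.exp (N * (β * (mag σ / N) ^ p)) := by
  have hN' : (N : ℝ) ≠ 0 := by positivity
  unfold cwWeight cwHamiltonian
  rw [← Fintype.sum_pow (fun a => spin (σ a)) p]
  change Real.exp (β * _ * mag σ ^ p + _) = _
  congr 1
  rw [zpow_sub₀ hN', div_pow]
  simp
  field_simp

lemma site_eq {N : ℕ} (hN : 1 ≤ N) (k : ℕ) : (2 * (k : ℝ) - N) / N = site N k := by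
  have hN' : (N : ℝ) ≠ 0 := by positivity
  unfold site; field_simp

lemma sum_cwWeight_indicator (p N : ℕ) (hN : 1 ≤ N) (β : ℝ) (S : Set ℝ) :
    ∑ σ : Fin N → Bool, {σ : Fin N → Bool | mag σ / N ∈ S}.indicator (cwWeight p N β 0) σ =
      ∑ k ∈ Finset.range (N + 1), S.indicator 1 (site N k) * levelWeight p N β k := by
  classical
  have h1 : ∀ σ : Fin N → Bool,
      {σ : Fin N → Bool | mag σ / N ∈ S}.indicator (cwWeight p N β 0) σ =
      (fun t : ℝ => S.indicator (1 : ℝ → ℝ) (t / N) * Real.exp (N * (β * (t / N) ^ p))) (mag σ) := by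
    intro σ
    by_cases h : mag σ / N ∈ S
    · simp [Set.indicator, h, cwWeight_eq p N hN]
    · simp [Set.indicator, h]
  rw [Finset.sum_congr rfl (fun σ _ => h1 σ),
    sum_mag N (fun t : ℝ => S.indicator (1 : ℝ → ℝ) (t / N) * Real.exp (N * (β * (t / N) ^ p)))]
  refine Finset.sum_congr rfl fun k _ => ?_
  simp only [site_eq hN, levelWeight]
  ring

lemma cwProb_eq (p N : ℕ) (hN : 1 ≤ N) (β : ℝ) (S : Set ℝ) :
    cwProb p N β 0 {σ | mag σ / N ∈ S} =
      (∑ k ∈ Finset.range (N + 1), S.indicator 1 (site N k) * levelWeight p N β k) /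
        ∑ k ∈ Finset.range (N + 1), levelWeight p N β k := by
  unfold cwProb
  rw [sum_cwWeight_indicator p N hN β S]
  congr 1
  have := sum_cwWeight_indicator p N hN β Set.univ
  simpa using this

lemma log_factorial_stirling_bounds {n : ℕ} (hn : n ≠ 0) :
    0 ≤ Real.log n.factorial - (n * log n - n + log n / 2 + log (2 * π) / 2) ∧
    Real.log n.factorial - (n * log n - n + log n / 2 + log (2 * π) / 2) ≤ 1 / n := by
  have hlow := Stirling.le_log_factorial_stirling hn
  refine ⟨by linarith, ?_⟩
  have hn0 : (0 : ℝ) < n := by positivity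
  have hform := Stirling.log_stirlingSeq_formula n
  rw [log_div hn0.ne' (exp_pos 1).ne', log_exp, log_mul two_ne_zero hn0.ne'] at hform
  have hup : log (Stirling.stirlingSeq n) - 1 / (12 * n) ≤ log √π := by
    have hmono : Monotone fun j : ℕ =>
        log (Stirling.stirlingSeq (j + 1)) - 1 / (12 * ((j : ℝ) + 1)) := by
      refine monotone_nat_of_le_succ fun j => ?_
      have := Stirling.log_stirlingSeq_sdiff_le (j + 1)
      have h3 : (1 : ℝ) / (12 * ((j + 1 : ℕ) : ℝ) * (((j + 1 : ℕ) : ℝ) + 1)) =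
          1 / (12 * ((j : ℝ) + 1)) - 1 / (12 * ((j : ℝ) + 1 + 1)) := by
        push_cast; field_simp; ring
      push_cast at this h3 ⊢
      linarith
    have hlim : Tendsto (fun j : ℕ =>
        log (Stirling.stirlingSeq (j + 1)) - 1 / (12 * ((j : ℝ) + 1))) atTop (𝓝 (log √π - 0)) := by
      refine Tendsto.sub ?_ ?_
      · exact (Stirling.tendsto_stirlingSeq_sqrt_pi.comp (tendsto_add_atTop_nat 1)).log
          (by positivity)
      · have := (tendsto_one_div_add_atTop_nhds_zero_nat (𝕜 := ℝ)).const_mul (1 / 12)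
        refine (this.congr fun j => ?_).trans (by simp)
        field_simp
    obtain ⟨j, rfl⟩ := Nat.exists_eq_succ_of_ne_zero hn
    have := hmono.ge_of_tendsto hlim j
    simpa using this
  rw [log_sqrt pi_pos.le] at hup
  rw [log_mul two_ne_zero pi_pos.ne']
  have : (1 : ℝ) / (12 * n) ≤ 1 / n := by
    apply one_div_le_one_div_of_le hn0; linarith
  linarith

lemma abs_log_choose_sub_le {N k : ℕ} (hk : 0 < k) (hkN : k < N) :
    |Real.log (N.choose k) - (N * log N - k * log k - (N - k) * log (N - k)
      + (log N - log k - log (N - k)) / 2 - log (2 * π) / 2)| ≤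
      1 / k + 1 / (N - k : ℝ) + 1 / N := by
  have hc : (N.choose k : ℝ) = N.factorial / (k.factorial * (N - k).factorial) :=
    Nat.cast_choose ℝ hkN.le
  have hsub : ((N - k : ℕ) : ℝ) = (N : ℝ) - k := by push_cast [hkN.le]; ring
  obtain ⟨a1, a2⟩ := log_factorial_stirling_bounds (n := N) (by omega)
  obtain ⟨b1, b2⟩ := log_factorial_stirling_bounds (n := k) (by omega)
  obtain ⟨c1, c2⟩ := log_factorial_stirling_bounds (n := N - k) (by omega)
  rw [hsub] at c1 c2
  rw [hc, log_div (by positivity) (by positivity), log_mul (by positivity) (by positivity)]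
  have p1 : (0 : ℝ) ≤ 1 / k := by positivity
  have p2 : (0 : ℝ) ≤ 1 / N := by positivity
  have p3 : (0 : ℝ) ≤ 1 / ((N : ℝ) - k) := by rw [← hsub]; positivity
  rw [abs_le]
  constructor <;> linarith

lemma site_bounds {N k : ℕ} (hk : k ∈ Finset.range (N + 1)) :
    site N k ∈ Set.Icc (-1 : ℝ) 1 := by
  have hk' : (k : ℝ) ≤ N := by exact_mod_cast Nat.lt_succ_iff.1 (Finset.mem_range.1 hk)
  unfold site
  rcases Nat.eq_zero_or_pos N with rfl | h
  · simp
  · have hN : (0 : ℝ) < N := by positivity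
    have h2 : 2 * (k : ℝ) / N ≤ 2 := by rw [div_le_iff₀ hN]; linarith
    have h0 : 0 ≤ 2 * (k : ℝ) / N := by positivity
    constructor <;> linarith

lemma abs_log_levelWeight_sub_le (p : ℕ) (β : ℝ) {N k : ℕ} (hk : 0 < k) (hkN : k < N) :
    |log (levelWeight p N β k) - (N * log 2 + N * Hfun p β 0 (site N k)
      + log (2 / (π * N)) / 2 - log (1 - site N k ^ 2) / 2)| ≤
      1 / k + 1 / (N - k : ℝ) + 1 / N := by
  have hk0 : (0 : ℝ) < k := by positivity
  have hN0 : (0 : ℝ) < N := by have : 0 < N := by omega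
                               positivity
  have hd : (0 : ℝ) < (N : ℝ) - k := by
    have : (k : ℝ) < N := by exact_mod_cast hkN
    linarith
  have h := abs_log_choose_sub_le hk hkN
  convert h using 2
  have e1 : 1 + site N k = 2 * k / N := by unfold site; ring
  have e2 : 1 - site N k = 2 * (N - k) / N := by unfold site; field_simp; ring
  have e3 : 1 - site N k ^ 2 = (2 * k / N) * (2 * (N - k) / N) := by rw [← e1, ← e2]; ring
  have hch : (0 : ℝ) < N.choose k := by exact_mod_cast Nat.choose_pos hkN.le
  unfold levelWeight Hfun binEnt
  rw [e1, e2, e3, log_mul hch.ne' (exp_pos _).ne', log_exp,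
    log_mul (by positivity) (by positivity), log_div (by positivity) hN0.ne',
    log_div (by positivity) hN0.ne', log_mul two_ne_zero hk0.ne', log_mul two_ne_zero hd.ne',
    log_div two_ne_zero (by positivity), log_mul pi_pos.ne' hN0.ne',
    log_mul two_ne_zero pi_pos.ne']
  field_simp
  ring

lemma levelWeight_le (p : ℕ) (β : ℝ) {N k : ℕ} (hN : 1 ≤ N) (hkN : k ≤ N) :
    levelWeight p N β k ≤ 2 ^ N * exp (N * Hfun p β 0 (site N k)) := by
  have hN0 : (0 : ℝ) < N := by positivity
  have hkR : (k : ℝ) ≤ N := by exact_mod_cast hkN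
  set q : ℝ := k / N with hq
  have hq0 : 0 ≤ q := by positivity
  have hq1 : q ≤ 1 := by rw [hq, div_le_one hN0]; exact hkR
  have hb : (N.choose k : ℝ) * (q ^ k * (1 - q) ^ (N - k)) ≤ 1 := by
    have := add_pow q (1 - q) N
    rw [add_sub_cancel, one_pow] at this
    refine le_trans (le_of_eq ?_) ((Finset.single_le_sum
      (f := fun m => q ^ m * (1 - q) ^ (N - m) * (N.choose m : ℝ)) ?_
      (Finset.mem_range.2 (Nat.lt_succ_of_le hkN))).trans this.ge)
    · ring
    · intro i _
      have : 0 ≤ 1 - q := by linarith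
      positivity
  have key : ∀ (n : ℕ) (t : ℝ), 0 ≤ t → (n = 0 ∨ 0 < t) → exp (n * log (2 * t)) = 2 ^ n * t ^ n := by
    rintro n t ht (rfl | h)
    · simp
    · rw [mul_comm, ← rpow_def_of_pos (by positivity), rpow_natCast, mul_pow]
  have hsub : ((N - k : ℕ) : ℝ) = (N : ℝ) - k := by push_cast [hkN]; ring
  have k1 := key k q hq0 (by
    rcases Nat.eq_zero_or_pos k with h | h
    · exact Or.inl h
    · right; positivity)
  have k2 := key (N - k) (1 - q) (by linarith) (by
    rcases Nat.eq_zero_or_pos (N - k) with h | h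
    · exact Or.inl h
    · right
      have : k < N := by omega
      have : (k : ℝ) < N := by exact_mod_cast this
      have : q < 1 := by rw [hq, div_lt_one hN0]; exact this
      linarith)
  have e1 : 1 + site N k = 2 * q := by unfold site; rw [hq]; ring
  have e2 : 1 - site N k = 2 * (1 - q) := by unfold site; rw [hq]; ring
  have hent : exp (N * binEnt (site N k)) = 2 ^ N * (q ^ k * (1 - q) ^ (N - k)) := by
    have h1 : N * binEnt (site N k) = k * log (2 * q) + (N - k : ℕ) * log (2 * (1 - q)) := by
      unfold binEnt
      rw [e1, e2, hsub, hq]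
      field_simp
    rw [h1, exp_add, k1, k2]
    have : (2 : ℝ) ^ N = 2 ^ k * 2 ^ (N - k) := by rw [← pow_add]; congr 1; omega
    rw [this]; ring
  have hH : exp (N * (β * site N k ^ p)) =
      exp (N * Hfun p β 0 (site N k)) * exp (N * binEnt (site N k)) := by
    rw [← exp_add]; congr 1; unfold Hfun; ring
  unfold levelWeight
  rw [hH, hent]
  have hE := (exp_pos (N * Hfun p β 0 (site N k))).le
  calc _ = (2 ^ N * exp (N * Hfun p β 0 (site N k))) *
        ((N.choose k : ℝ) * (q ^ k * (1 - q) ^ (N - k))) := by ring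
    _ ≤ (2 ^ N * exp (N * Hfun p β 0 (site N k))) * 1 := by gcongr
    _ = _ := mul_one _

/-- The unnormalized Gaussian distribution function `y ↦ ∫_{-∞}^y exp (-b t²) dt`. -/
def gaussInt (b y : ℝ) : ℝ := ∫ t in Set.Iic y, exp (-b * t ^ 2)

lemma hasDerivAt_gaussInt {b : ℝ} (hb : 0 < b) (y : ℝ) :
    HasDerivAt (gaussInt b) (exp (-b * y ^ 2)) y := by
  have hint := integrable_exp_neg_mul_sq hb
  have hcont : Continuous fun t : ℝ => exp (-b * t ^ 2) := by fun_prop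
  have h : gaussInt b = fun z => gaussInt b 0 + ∫ t in (0 : ℝ)..z, exp (-b * t ^ 2) := by
    funext z
    unfold gaussInt
    rw [← intervalIntegral.integral_Iic_sub_Iic hint.integrableOn hint.integrableOn]
    ring
  rw [h]
  exact ((hcont.integral_hasStrictDerivAt 0 y).hasDerivAt).const_add _

lemma gaussInt_mono {b : ℝ} (hb : 0 < b) : Monotone (gaussInt b) :=
  monotone_of_hasDerivAt_nonneg (hasDerivAt_gaussInt hb) fun _ => (exp_pos _).le

lemma gaussInt_nonneg (b y : ℝ) : 0 ≤ gaussInt b y :=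
  integral_nonneg fun _ => (exp_pos _).le

lemma gaussInt_add_neg {b : ℝ} (hb : 0 < b) (y : ℝ) :
    gaussInt b y + gaussInt b (-y) = √(π / b) := by
  have hint := integrable_exp_neg_mul_sq hb
  have h1 : gaussInt b (-y) = ∫ t in Set.Ioi y, exp (-b * t ^ 2) := by
    have := integral_comp_neg_Iic (-y) (fun t => exp (-b * t ^ 2))
    simp only [neg_neg, neg_sq] at this
    exact this
  rw [h1, ← integral_gaussian b, gaussInt, ← Set.compl_Iic]
  exact integral_add_compl measurableSet_Iic hint

lemma gaussInt_le {b : ℝ} (hb : 0 < b) (y : ℝ) : gaussInt b y ≤ √(π / b) := by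
  linarith [gaussInt_add_neg hb y, gaussInt_nonneg b (-y)]

lemma exists_gaussInt_tail_le {b : ℝ} (hb : 0 < b) :
    ∃ M, 0 < M ∧ ∀ T, 0 < T → gaussInt b (-T) ≤ M / T := by
  have hint := integrable_exp_neg_mul_sq hb
  have hint1 : Integrable fun t : ℝ => |t * exp (-b * t ^ 2)| :=
    (integrable_mul_exp_neg_mul_sq hb).abs
  have h0 : 0 ≤ ∫ t : ℝ, |t * exp (-b * t ^ 2)| := integral_nonneg fun _ => abs_nonneg _
  refine ⟨(∫ t : ℝ, |t * exp (-b * t ^ 2)|) + 1, by linarith, fun T hT => ?_⟩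
  calc gaussInt b (-T) ≤ ∫ t in Set.Iic (-T), |t * exp (-b * t ^ 2)| / T := by
        refine setIntegral_mono_on hint.integrableOn (hint1.div_const T).integrableOn
          measurableSet_Iic fun t ht => ?_
        have ht' : T ≤ |t| := by
          rw [le_abs]; right; linarith [Set.mem_Iic.1 ht]
        rw [abs_mul, abs_of_pos (exp_pos _), le_div_iff₀ hT, mul_comm]
        gcongr
    _ ≤ ∫ t : ℝ, |t * exp (-b * t ^ 2)| / T :=
        setIntegral_le_integral (hint1.div_const T) (Eventually.of_forall fun t => by positivity)
    _ = (∫ t : ℝ, |t * exp (-b * t ^ 2)|) / T := integral_div _ _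
    _ ≤ _ := by gcongr; linarith

lemma abs_gaussInt_sub_le {b : ℝ} (hb : 0 < b) {y z B : ℝ}
    (hB : ∀ t ∈ Set.uIcc y z, exp (-b * t ^ 2) ≤ B) :
    |gaussInt b z - gaussInt b y| ≤ B * |z - y| := by
  have := Convex.norm_image_sub_le_of_norm_hasDerivWithin_le (s := Set.uIcc y z) (C := B)
    (f := gaussInt b) (f' := fun t => exp (-b * t ^ 2)) (x := y) (y := z)
    (fun t _ => (hasDerivAt_gaussInt hb t).hasDerivWithinAt)
    (fun t ht => by rw [Real.norm_eq_abs, abs_of_pos (exp_pos _)]; exact hB t ht)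
    (convex_uIcc y z) Set.left_mem_uIcc Set.right_mem_uIcc
  simpa [Real.norm_eq_abs] using this

/-- The Gaussian density oscillates by at most the increments of a monotone function
with values in `[0, 2]`. -/
lemma exists_monotone_control {b : ℝ} (hb : 0 < b) :
    ∃ V : ℝ → ℝ, (∀ y, 0 ≤ V y ∧ V y ≤ 2) ∧
      ∀ s t, s ≤ t → |exp (-b * t ^ 2) - exp (-b * s ^ 2)| ≤ V t - V s := by
  have h1 : ∀ t : ℝ, exp (-b * t ^ 2) ≤ 1 := fun t => by
    rw [exp_le_one_iff]; nlinarith [sq_nonneg t]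
  refine ⟨fun y => if y ≤ 0 then exp (-b * y ^ 2) else 2 - exp (-b * y ^ 2), ?_, ?_⟩
  · intro y
    have := h1 y
    have := exp_pos (-b * y ^ 2)
    dsimp only
    split_ifs <;> constructor <;> linarith
  · intro s t hst
    have hs := h1 s
    have ht := h1 t
    have hs0 := exp_pos (-b * s ^ 2)
    have ht0 := exp_pos (-b * t ^ 2)
    dsimp only
    split_ifs with h2 h3 h3
    · rw [abs_of_nonneg]
      rw [sub_nonneg, exp_le_exp]
      nlinarith [mul_nonneg hb.le (mul_nonneg (sub_nonneg.2 hst) (by linarith : 0 ≤ -(s + t)))]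
    · exact absurd (hst.trans h2) h3
    · rw [abs_le]; constructor <;> linarith
    · rw [abs_of_nonpos]
      · linarith
      rw [sub_nonpos, exp_le_exp]
      push Not at h2 h3
      nlinarith [mul_nonneg hb.le (mul_nonneg (sub_nonneg.2 hst) (by linarith : 0 ≤ (s + t)))]

lemma abs_riemann_sum_sub_gaussInt_le {b : ℝ} (hb : 0 < b) {h : ℝ} (hh : 0 < h) {Y : ℕ → ℝ}
    (hY : ∀ k, Y (k + 1) = Y k + h) {i j : ℕ} (hij : i ≤ j) :
    |h * ∑ k ∈ Finset.Ico i j, exp (-b * Y k ^ 2)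
      - (gaussInt b (Y j - h) - gaussInt b (Y i - h))| ≤ 2 * h := by
  obtain ⟨V, hV, hosc⟩ := exists_monotone_control hb
  have step : ∀ y, |h * exp (-b * y ^ 2) - (gaussInt b y - gaussInt b (y - h))| ≤
      h * (V y - V (y - h)) := by
    intro y
    obtain ⟨c, ⟨hc1, hc2⟩, hc⟩ := exists_hasDerivAt_eq_slope (gaussInt b)
      (fun t => exp (-b * t ^ 2)) (by linarith : y - h < y)
      (fun t _ => (hasDerivAt_gaussInt hb t).continuousAt.continuousWithinAt)
      (fun t _ => hasDerivAt_gaussInt hb t)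
    rw [sub_sub_cancel, eq_div_iff hh.ne'] at hc
    rw [← hc, mul_comm _ h, ← mul_sub, abs_mul, abs_of_pos hh]
    gcongr
    have h1 := hosc c y hc2.le
    have h2 := (abs_nonneg _).trans (hosc (y - h) c hc1.le)
    linarith
  have tele : ∀ n, i ≤ n → |h * ∑ k ∈ Finset.Ico i n, exp (-b * Y k ^ 2)
      - (gaussInt b (Y n - h) - gaussInt b (Y i - h))| ≤ h * (V (Y n - h) - V (Y i - h)) := by
    intro n hn
    induction n, hn using Nat.le_induction with
    | base => simp
    | succ n hn ih =>
      have hs := step (Y n)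
      rw [Finset.sum_Ico_succ_top hn, hY n, add_sub_cancel_right]
      rw [abs_le] at *
      constructor <;> linarith
  refine (tele j hij).trans ?_
  have := (hV (Y j - h)).2
  have := (hV (Y i - h)).1
  nlinarith

lemma gaussCDF_eq {b γ : ℝ} (hb : 0 < b) (hγ : 0 < γ) (x : ℝ) :
    gaussCDF (γ ^ 2 / (2 * b)) x = gaussInt b (x / γ) / √(π / b) := by
  unfold gaussCDF gaussProb
  rw [integral_const_mul, ← integral_indicator measurableSet_Iic]
  set F : ℝ → ℝ := (Set.Iic x).indicator fun t => exp (-t ^ 2 / (2 * (γ ^ 2 / (2 * b)))) with hF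
  have h1 : gaussInt b (x / γ) = ∫ t, F (γ * t) := by
    unfold gaussInt
    rw [← integral_indicator measurableSet_Iic]
    congr 1
    funext t
    have hiff : t ≤ x / γ ↔ γ * t ≤ x := by rw [le_div_iff₀ hγ, mul_comm]
    by_cases ht : γ * t ≤ x
    · rw [hF, Set.indicator_of_mem (Set.mem_Iic.2 (hiff.2 ht)),
        Set.indicator_of_mem (Set.mem_Iic.2 ht)]
      congr 1
      field_simp
    · rw [hF, Set.indicator_of_notMem (s := Set.Iic (x / γ)) (fun h => ht (hiff.1 h)),
        Set.indicator_of_notMem (s := Set.Iic x) ht]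
  rw [Measure.integral_comp_mul_left, smul_eq_mul, abs_of_pos (inv_pos.2 hγ)] at h1
  have h2 : √(2 * π * (γ ^ 2 / (2 * b))) = γ * √(π / b) := by
    rw [show 2 * π * (γ ^ 2 / (2 * b)) = γ ^ 2 * (π / b) by field_simp,
      sqrt_mul (by positivity), sqrt_sq hγ.le]
  have h3 : 0 < √(π / b) := by positivity
  rw [h1, h2]
  field_simp

lemma hasDerivAt_arctanh {x : ℝ} (hx : x ∈ Set.Ioo (-1 : ℝ) 1) :
    HasDerivAt arctanh (1 / (1 - x ^ 2)) x := by
  have h1 : 0 < 1 + x := by linarith [hx.1]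
  have h2 : 0 < 1 - x := by linarith [hx.2]
  have h3 : 1 - x ^ 2 ≠ 0 := by nlinarith [mul_pos h1 h2]
  have hd := ((((hasDerivAt_id x).const_add 1).div ((hasDerivAt_id x).const_sub 1) h2.ne').log
    (div_pos h1 h2).ne').const_mul (1 / 2 : ℝ)
  refine hd.congr_deriv ?_
  simp only [id, Pi.div_apply]
  field_simp
  ring

lemma arctanh_eq_sub {x : ℝ} (hx : x ∈ Set.Ioo (-1 : ℝ) 1) :
    arctanh x = (log (1 + x) - log (1 - x)) / 2 := by
  unfold arctanh
  rw [log_div (by linarith [hx.1]) (by linarith [hx.2])]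
  ring

lemma hasDerivAt_binEnt {x : ℝ} (hx : x ∈ Set.Ioo (-1 : ℝ) 1) :
    HasDerivAt binEnt (arctanh x) x := by
  have h1 : 1 + x ≠ 0 := by linarith [hx.1]
  have h2 : 1 - x ≠ 0 := by linarith [hx.2]
  have ha := (hasDerivAt_id x).const_add 1
  have hb := (hasDerivAt_id x).const_sub 1
  have hd := ((ha.mul (ha.log h1)).add (hb.mul (hb.log h2))).const_mul (1 / 2 : ℝ)
  refine hd.congr_deriv ?_
  rw [arctanh_eq_sub hx]
  simp only [id]
  field_simp
  ring

lemma continuous_binEnt : Continuous binEnt := by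
  have h : Continuous fun x : ℝ => x * log x := continuous_mul_log
  unfold binEnt
  exact ((h.comp (continuous_const.add continuous_id)).add
    (h.comp (continuous_const.sub continuous_id))).const_smul (1 / 2 : ℝ)

lemma continuous_Hfun (p : ℕ) (β : ℝ) : Continuous (Hfun p β 0) := by
  have := continuous_binEnt
  unfold Hfun
  fun_prop

/-- The derivative of `Hfun p β 0`. -/
def Hderiv (p : ℕ) (β x : ℝ) : ℝ := β * p * x ^ (p - 1) - arctanh x

/-- The second derivative of `Hfun p β 0`. -/
def Hderiv2 (p : ℕ) (β x : ℝ) : ℝ := β * p * (p - 1) * x ^ (p - 2) - 1 / (1 - x ^ 2)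

lemma hasDerivAt_Hfun (p : ℕ) (β : ℝ) {x : ℝ} (hx : x ∈ Set.Ioo (-1 : ℝ) 1) :
    HasDerivAt (Hfun p β 0) (Hderiv p β x) x := by
  have h := (((hasDerivAt_pow p x).const_mul β).add ((hasDerivAt_id x).const_mul 0)).sub
    (hasDerivAt_binEnt hx)
  refine h.congr_deriv ?_
  unfold Hderiv
  ring

lemma hasDerivAt_Hderiv {p : ℕ} (hp : 3 ≤ p) (β : ℝ) {x : ℝ} (hx : x ∈ Set.Ioo (-1 : ℝ) 1) :
    HasDerivAt (Hderiv p β) (Hderiv2 p β x) x := by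
  have h := ((hasDerivAt_pow (p - 1) x).const_mul (β * p)).sub (hasDerivAt_arctanh hx)
  refine h.congr_deriv ?_
  unfold Hderiv2
  rw [show p - 1 - 1 = p - 2 by omega]
  push_cast [show 1 ≤ p by omega]
  ring

lemma differentiableAt_Hderiv2 (p : ℕ) (β : ℝ) {x : ℝ} (hx : x ∈ Set.Ioo (-1 : ℝ) 1) :
    DifferentiableAt ℝ (Hderiv2 p β) x := by
  have h : 1 - x ^ 2 ≠ 0 := by nlinarith [hx.1, hx.2]
  unfold Hderiv2
  fun_prop (disch := assumption)

lemma iteratedDeriv_two_Hfun {p : ℕ} (hp : 3 ≤ p) (β : ℝ) {x : ℝ}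
    (hx : x ∈ Set.Ioo (-1 : ℝ) 1) : iteratedDeriv 2 (Hfun p β 0) x = Hderiv2 p β x := by
  rw [iteratedDeriv_succ, iteratedDeriv_one]
  have h : deriv (Hfun p β 0) =ᶠ[𝓝 x] Hderiv p β := by
    filter_upwards [isOpen_Ioo.mem_nhds hx] with y hy
    exact (hasDerivAt_Hfun p β hy).deriv
  rw [h.deriv_eq]
  exact (hasDerivAt_Hderiv hp β hx).deriv

/-- The numerator of the derivative of `gMPL`. -/
def gNum (p : ℕ) (x : ℝ) : ℝ := x / (1 - x ^ 2) - (p - 1) * arctanh x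

lemma hasDerivAt_gNum (p : ℕ) {x : ℝ} (hx : x ∈ Set.Ioo (-1 : ℝ) 1) :
    HasDerivAt (gNum p) ((p * x ^ 2 - (p - 2)) / (1 - x ^ 2) ^ 2) x := by
  have h : 1 - x ^ 2 ≠ 0 := by nlinarith [hx.1, hx.2]
  have hd := ((hasDerivAt_id x).div ((hasDerivAt_pow 2 x).const_sub 1) h).sub
    ((hasDerivAt_arctanh hx).const_mul ((p : ℝ) - 1))
  refine hd.congr_deriv ?_
  simp only [id]
  field_simp
  push_cast
  ring

lemma hasDerivAt_gMPL {p : ℕ} (hp : 3 ≤ p) {x : ℝ} (hx : x ∈ Set.Ioo (0 : ℝ) 1) :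
    HasDerivAt (gMPL p) (gNum p x / (p * x ^ p)) x := by
  have hx' : x ∈ Set.Ioo (-1 : ℝ) 1 := ⟨by linarith [hx.1], hx.2⟩
  have hx0 := hx.1
  have h : 1 - x ^ 2 ≠ 0 := by nlinarith [hx.1, hx.2]
  have hp0 : (0 : ℝ) < p := by positivity
  have hd := (hasDerivAt_arctanh hx').div ((hasDerivAt_pow (p - 1) x).const_mul (p : ℝ))
    (by positivity)
  refine hd.congr_deriv ?_
  unfold gNum
  obtain ⟨q, rfl⟩ : ∃ q, p = q + 2 := ⟨p - 2, by omega⟩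
  simp only [show q + 2 - 1 = q + 1 by omega, show q + 1 - 1 = q by omega]
  field_simp
  push_cast
  ring

lemma Hderiv_eq {p : ℕ} (hp : 3 ≤ p) (β : ℝ) {x : ℝ} (hx : 0 < x) :
    Hderiv p β x = p * x ^ (p - 1) * (β - gMPL p x) := by
  have hp0 : (0 : ℝ) < p := by positivity
  unfold Hderiv gMPL
  field_simp

lemma arctanh_zero : arctanh 0 = 0 := by simp [arctanh]

lemma gNum_zero (p : ℕ) : gNum p 0 = 0 := by simp [gNum, arctanh_zero]

/-- `gNum p` first decreases from `0`, then increases: below a point of `(0, 1)` where it is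
nonpositive it is negative, and above a point where it is positive it is positive. -/
lemma gNum_neg_of_lt {p : ℕ} (hp : 3 ≤ p) {m x : ℝ} (hm : m < 1) (hk : gNum p m ≤ 0)
    (hx : 0 < x) (hxm : x < m) : gNum p x < 0 := by
  have hp0 : (3 : ℝ) ≤ p := by exact_mod_cast hp
  have hne : ∀ y ∈ Set.Ioo (-1 : ℝ) 1, 0 < (1 - y ^ 2) ^ 2 := fun y hy => by
    have : 0 < 1 - y ^ 2 := by nlinarith [hy.1, hy.2]
    positivity
  rcases le_or_gt (p * x ^ 2) (p - 2) with h | h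
  · have hanti : StrictAntiOn (gNum p) (Set.Icc 0 x) := by
      refine strictAntiOn_of_hasDerivWithinAt_neg (convex_Icc 0 x)
        (f' := fun y => (p * y ^ 2 - (p - 2)) / (1 - y ^ 2) ^ 2) ?_ ?_ ?_
      · intro y hy
        exact (hasDerivAt_gNum p ⟨by linarith [hy.1], by linarith [hy.2]⟩).continuousAt.continuousWithinAt
      · intro y hy
        rw [interior_Icc] at hy
        exact (hasDerivAt_gNum p ⟨by linarith [hy.1], by linarith [hy.2]⟩).hasDerivWithinAt
      · intro y hy
        rw [interior_Icc] at hy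
        refine div_neg_of_neg_of_pos ?_ (hne y ⟨by linarith [hy.1], by linarith [hy.2]⟩)
        have : y ^ 2 < x ^ 2 := by nlinarith [hy.1, hy.2]
        nlinarith
    have := hanti (Set.left_mem_Icc.2 hx.le) (Set.right_mem_Icc.2 hx.le) hx
    rwa [gNum_zero] at this
  · have hmono : StrictMonoOn (gNum p) (Set.Icc x m) := by
      refine strictMonoOn_of_hasDerivWithinAt_pos (convex_Icc x m)
        (f' := fun y => (p * y ^ 2 - (p - 2)) / (1 - y ^ 2) ^ 2) ?_ ?_ ?_
      · intro y hy
        exact (hasDerivAt_gNum p ⟨by linarith [hy.1], by linarith [hy.2]⟩).continuousAt.continuousWithinAt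
      · intro y hy
        rw [interior_Icc] at hy
        exact (hasDerivAt_gNum p ⟨by linarith [hy.1], by linarith [hy.2]⟩).hasDerivWithinAt
      · intro y hy
        rw [interior_Icc] at hy
        refine div_pos ?_ (hne y ⟨by linarith [hy.1], by linarith [hy.2]⟩)
        have : x ^ 2 < y ^ 2 := by nlinarith [hy.1, hy.2]
        nlinarith
    exact (hmono (Set.left_mem_Icc.2 hxm.le) (Set.right_mem_Icc.2 hxm.le) hxm).trans_le hk

lemma gNum_pos_of_lt {p : ℕ} (hp : 3 ≤ p) {m x : ℝ} (hm : 0 < m) (hk : 0 < gNum p m)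
    (hxm : m < x) (hx : x < 1) : 0 < gNum p x := by
  by_contra! h
  exact absurd (gNum_neg_of_lt hp hx h hm hxm) hk.not_gt

lemma betaStar_nonneg (p : ℕ) : 0 ≤ betaStar p := Real.sInf_nonneg fun _ hb => hb.1

lemma Hfun_zero {p : ℕ} (hp : 3 ≤ p) (β : ℝ) : Hfun p β 0 0 = 0 := by
  simp [Hfun, binEnt, show p ≠ 0 by omega]

lemma Hfun_maximizer_pos {p : ℕ} {β m : ℝ} (hβ : betaStar p < β)
    (hmax : isMaximizer p β 0 m) : 0 < Hfun p β 0 m := by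
  have hne : {b : ℝ | 0 ≤ b ∧ ∃ x ∈ Set.Icc (0:ℝ) 1, 0 < Hfun p b 0 x}.Nonempty := by
    refine ⟨1, zero_le_one, 1, ⟨zero_le_one, le_rfl⟩, ?_⟩
    have : log 2 < 1 := by linarith [log_two_lt_d9]
    simp only [Hfun, binEnt]
    norm_num
    linarith
  obtain ⟨b, ⟨_, x, hx, hpos⟩, hbβ⟩ := exists_lt_of_csInf_lt hne hβ
  refine lt_of_lt_of_le ?_ (hmax.2 x ⟨by linarith [hx.1], hx.2⟩)
  refine hpos.trans_le ?_
  unfold Hfun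
  have : b * x ^ p ≤ β * x ^ p := mul_le_mul_of_nonneg_right hbβ.le (pow_nonneg hx.1 p)
  linarith

lemma Hderiv_maximizer {p : ℕ} {β m : ℝ} (hmax : isMaximizer p β 0 m) : Hderiv p β m = 0 := by
  have hloc : IsLocalMax (Hfun p β 0) m := by
    filter_upwards [isOpen_Ioo.mem_nhds hmax.1] with y hy
    exact hmax.2 y ⟨hy.1.le, hy.2.le⟩
  exact hloc.hasDerivAt_eq_zero (hasDerivAt_Hfun p β hmax.1)

lemma gMPL_maximizer {p : ℕ} (hp : 3 ≤ p) {β m : ℝ} (hm : 0 < m)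
    (hmax : isMaximizer p β 0 m) : gMPL p m = β := by
  have h := Hderiv_maximizer hmax
  rw [Hderiv_eq hp β hm] at h
  have hp0 : (0 : ℝ) < p := by positivity
  have : (p : ℝ) * m ^ (p - 1) ≠ 0 := by positivity
  rcases mul_eq_zero.1 h with h | h
  · exact absurd h this
  · linarith

lemma gNum_maximizer_pos {p : ℕ} (hp : 3 ≤ p) {β m : ℝ} (hβ : betaStar p < β) (hm : 0 < m)
    (hmax : isMaximizer p β 0 m) : 0 < gNum p m := by
  by_contra! hk
  have hm1 := hmax.1.2
  have hp0 : (0 : ℝ) < p := by positivity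
  have hg : StrictAntiOn (gMPL p) (Set.Ioc 0 m) := by
    refine strictAntiOn_of_hasDerivWithinAt_neg (convex_Ioc 0 m)
      (f' := fun y => gNum p y / (p * y ^ p)) ?_ ?_ ?_
    · intro y hy
      exact (hasDerivAt_gMPL hp ⟨hy.1, by linarith [hy.2]⟩).continuousAt.continuousWithinAt
    · intro y hy
      rw [interior_Ioc] at hy
      exact (hasDerivAt_gMPL hp ⟨hy.1, by linarith [hy.2]⟩).hasDerivWithinAt
    · intro y hy
      rw [interior_Ioc] at hy
      have := hy.1
      exact div_neg_of_neg_of_pos (gNum_neg_of_lt hp hm1 hk hy.1 hy.2) (by positivity)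
  have hH : StrictAntiOn (Hfun p β 0) (Set.Icc 0 m) := by
    refine strictAntiOn_of_hasDerivWithinAt_neg (convex_Icc 0 m) (f' := Hderiv p β)
      (continuous_Hfun p β).continuousOn ?_ ?_
    · intro y hy
      rw [interior_Icc] at hy
      exact (hasDerivAt_Hfun p β ⟨by linarith [hy.1], by linarith [hy.2]⟩).hasDerivWithinAt
    · intro y hy
      rw [interior_Icc] at hy
      have hy0 := hy.1
      rw [Hderiv_eq hp β hy0]
      have := hg ⟨hy.1, hy.2.le⟩ ⟨hm, le_rfl⟩ hy.2
      rw [gMPL_maximizer hp hm hmax] at this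
      exact mul_neg_of_pos_of_neg (by positivity) (by linarith)
  have := hH (Set.left_mem_Icc.2 hm.le) (Set.right_mem_Icc.2 hm.le) hm
  rw [Hfun_zero hp] at this
  linarith [Hfun_maximizer_pos hβ hmax]

lemma Hfun_one_lt {p : ℕ} (hp : 3 ≤ p) {β m : ℝ} (hβ : betaStar p < β) (hm : 0 < m)
    (hmax : isMaximizer p β 0 m) : Hfun p β 0 1 < Hfun p β 0 m := by
  have hk := gNum_maximizer_pos hp hβ hm hmax
  have hm1 := hmax.1.2
  have hp0 : (0 : ℝ) < p := by positivity
  have hg : StrictMonoOn (gMPL p) (Set.Ico m 1) := by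
    refine strictMonoOn_of_hasDerivWithinAt_pos (convex_Ico m 1)
      (f' := fun y => gNum p y / (p * y ^ p)) ?_ ?_ ?_
    · intro y hy
      exact (hasDerivAt_gMPL hp ⟨by linarith [hy.1], hy.2⟩).continuousAt.continuousWithinAt
    · intro y hy
      rw [interior_Ico] at hy
      exact (hasDerivAt_gMPL hp ⟨by linarith [hy.1], hy.2⟩).hasDerivWithinAt
    · intro y hy
      rw [interior_Ico] at hy
      have : 0 < y := hm.trans hy.1
      exact div_pos (gNum_pos_of_lt hp hm hk hy.1 hy.2) (by positivity)
  have hH : StrictAntiOn (Hfun p β 0) (Set.Icc m 1) := by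
    refine strictAntiOn_of_hasDerivWithinAt_neg (convex_Icc m 1) (f' := Hderiv p β)
      (continuous_Hfun p β).continuousOn ?_ ?_
    · intro y hy
      rw [interior_Icc] at hy
      exact (hasDerivAt_Hfun p β ⟨by linarith [hy.1], hy.2⟩).hasDerivWithinAt
    · intro y hy
      rw [interior_Icc] at hy
      have hy0 : 0 < y := hm.trans hy.1
      rw [Hderiv_eq hp β hy0]
      have := hg ⟨le_rfl, hm1⟩ ⟨hy.1.le, hy.2⟩ hy.1
      rw [gMPL_maximizer hp hm hmax] at this
      exact mul_neg_of_pos_of_neg (by positivity) (by linarith)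
  exact hH (Set.left_mem_Icc.2 hm1.le) (Set.right_mem_Icc.2 hm1.le) hm1

lemma Hderiv2_maximizer {p : ℕ} (hp : 3 ≤ p) {β m : ℝ} (hm : 0 < m)
    (hmax : isMaximizer p β 0 m) : -Hderiv2 p β m = gNum p m / m := by
  have h := Hderiv_maximizer hmax
  unfold Hderiv at h
  have hm2 : 1 - m ^ 2 ≠ 0 := by nlinarith [hmax.1.1, hmax.1.2]
  have : arctanh m = β * p * (m ^ (p - 2) * m) := by
    rw [← pow_succ, show p - 2 + 1 = p - 1 by omega]; linarith
  unfold Hderiv2 gNum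
  rw [this]
  field_simp
  ring

lemma binEnt_neg (x : ℝ) : binEnt (-x) = binEnt x := by
  unfold binEnt
  rw [sub_neg_eq_add, ← sub_eq_add_neg]
  ring

lemma eq_of_Hfun_eq {p : ℕ} (hp : 3 ≤ p) {β m : ℝ} (hβ : betaStar p < β) (hm : 0 < m)
    (hmax : isMaximizer p β 0 m) (huniq : ∀ m', 0 < m' → isMaximizer p β 0 m' → m' = m)
    {x : ℝ} (hx : x ∈ Set.Icc (-1 : ℝ) 1) (hH : Hfun p β 0 x = Hfun p β 0 m) :
    x = m ∨ (Even p ∧ x = -m) := by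
  have hpos : ∀ y ∈ Set.Icc (0 : ℝ) 1, Hfun p β 0 y = Hfun p β 0 m → y = m := by
    intro y hy hyH
    have h0 : y ≠ 0 := by
      rintro rfl
      rw [Hfun_zero hp] at hyH
      linarith [Hfun_maximizer_pos hβ hmax]
    have h1 : y ≠ 1 := by
      rintro rfl
      exact (Hfun_one_lt hp hβ hm hmax).ne hyH
    have hy0 : 0 < y := lt_of_le_of_ne hy.1 (Ne.symm h0)
    refine huniq y hy0 ⟨⟨by linarith, lt_of_le_of_ne hy.2 h1⟩, fun z hz => ?_⟩
    rw [hyH]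
    exact hmax.2 z hz
  rcases le_or_gt 0 x with h | h
  · exact Or.inl (hpos x ⟨h, hx.2⟩ hH)
  · right
    have hnx : -x ∈ Set.Icc (-1 : ℝ) 1 := ⟨by linarith [hx.2], by linarith [hx.1]⟩
    have hev : Even p := by
      by_contra hodd
      rw [Nat.not_even_iff_odd] at hodd
      have h1 := hmax.2 (-x) hnx
      rw [← hH] at h1
      unfold Hfun at h1
      rw [binEnt_neg, hodd.neg_pow] at h1
      have h2 : 0 < (-x) ^ p := pow_pos (by linarith) p
      rw [hodd.neg_pow] at h2
      nlinarith [betaStar_nonneg p, mul_pos ((betaStar_nonneg p).trans_lt hβ) h2]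
    refine ⟨hev, ?_⟩
    have : -x = m := hpos (-x) ⟨by linarith, hnx.2⟩ (by
      rw [← hH]; unfold Hfun; rw [binEnt_neg, hev.neg_pow]; ring)
    linarith

lemma exists_Hfun_gap {p : ℕ} (hp : 3 ≤ p) {β m : ℝ} (hβ : betaStar p < β) (hm : 0 < m)
    (hmax : isMaximizer p β 0 m) (huniq : ∀ m', 0 < m' → isMaximizer p β 0 m' → m' = m)
    {δ : ℝ} (hδ : 0 < δ) :
    ∃ η, 0 < η ∧ ∀ x ∈ Set.Icc (-1 : ℝ) 1, δ ≤ |x - m| → (Even p → δ ≤ |x + m|) →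
      Hfun p β 0 x ≤ Hfun p β 0 m - η := by
  set S : Set ℝ := Set.Icc (-1 : ℝ) 1 ∩ ({x | δ ≤ |x - m|} ∩ {x | Even p → δ ≤ |x + m|}) with hS
  have hclosed : IsClosed {x : ℝ | Even p → δ ≤ |x + m|} := by
    by_cases hev : Even p
    · simp only [hev, forall_const]
      exact isClosed_le continuous_const (by fun_prop)
    · simp [hev]
  have hcomp : IsCompact S :=
    isCompact_Icc.inter_right ((isClosed_le continuous_const (by fun_prop)).inter hclosed)
  rcases S.eq_empty_or_nonempty with hempty | hne
  · refine ⟨1, one_pos, fun x hx h1 h2 => ?_⟩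
    have : x ∈ S := ⟨hx, h1, h2⟩
    rw [hempty] at this
    exact this.elim
  · obtain ⟨z, ⟨hz, hz1, hz2⟩, hzmax⟩ :=
      hcomp.exists_isMaxOn hne (continuous_Hfun p β).continuousOn
    have hlt : Hfun p β 0 z < Hfun p β 0 m := by
      refine lt_of_le_of_ne (hmax.2 z hz) fun heq => ?_
      rcases eq_of_Hfun_eq hp hβ hm hmax huniq hz heq with rfl | ⟨hev, rfl⟩
      · simp at hz1; linarith
      · have := hz2 hev
        simp at this; linarith
    refine ⟨_, sub_pos.2 hlt, fun x hx h1 h2 => ?_⟩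
    have := hzmax (show x ∈ S from ⟨hx, h1, h2⟩)
    simp only [Set.mem_ofPred_eq] at this
    linarith

lemma isBigO_sub_of_deriv {F F' : ℝ → ℝ} {m : ℝ} {n : ℕ}
    (hF : ∀ᶠ x in 𝓝 m, HasDerivAt F (F' x) x) (hO : F' =O[𝓝 m] fun x => (x - m) ^ n) :
    (fun x => F x - F m) =O[𝓝 m] fun x => (x - m) ^ (n + 1) := by
  obtain ⟨c, hc⟩ := hO.bound
  obtain ⟨ε, hε, hball⟩ := Metric.eventually_nhds_iff_ball.1 (hF.and hc)
  refine Asymptotics.IsBigO.of_bound c ?_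
  filter_upwards [Metric.ball_mem_nhds m hε] with x hx
  have hsub : ∀ y ∈ Set.uIcc m x, y ∈ Metric.ball m ε ∧ |y - m| ≤ |x - m| := by
    intro y hy
    have h2 : |y - m| ≤ |x - m| := Set.abs_sub_left_of_mem_uIcc hy
    refine ⟨?_, h2⟩
    rw [Metric.mem_ball, Real.dist_eq] at hx ⊢
    exact h2.trans_lt hx
  by_cases hxm : x = m
  · simp [hxm]
  have hc0 : 0 ≤ c := by
    have h3 := (norm_nonneg _).trans (hball x hx).2
    by_contra! hneg
    have : 0 < ‖(x - m) ^ n‖ := norm_pos_iff.2 (pow_ne_zero n (sub_ne_zero.2 hxm))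
    nlinarith
  have := Convex.norm_image_sub_le_of_norm_hasDerivWithin_le (s := Set.uIcc m x)
    (C := c * |x - m| ^ n) (f := F) (f' := F') (x := m) (y := x)
    (fun t ht => (hball t (hsub t ht).1).1.hasDerivWithinAt)
    (fun t ht => by
      refine (hball t (hsub t ht).1).2.trans ?_
      rw [norm_pow, Real.norm_eq_abs]
      have := (hsub t ht).2
      gcongr)
    (convex_uIcc m x) Set.left_mem_uIcc Set.right_mem_uIcc
  refine this.trans (le_of_eq ?_)
  rw [norm_pow, Real.norm_eq_abs]
  ring

lemma Hfun_isBigO {p : ℕ} (hp : 3 ≤ p) {β m : ℝ} (hmax : isMaximizer p β 0 m) :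
    (fun x => Hfun p β 0 x - Hfun p β 0 m - Hderiv2 p β m / 2 * (x - m) ^ 2)
      =O[𝓝 m] fun x => (x - m) ^ 3 := by
  have hnhds : ∀ᶠ x in 𝓝 m, x ∈ Set.Ioo (-1 : ℝ) 1 := isOpen_Ioo.mem_nhds hmax.1
  have h2 : (fun x => Hderiv2 p β x - Hderiv2 p β m) =O[𝓝 m] fun x => (x - m) ^ 1 := by
    simpa using (differentiableAt_Hderiv2 p β hmax.1).isBigO_sub
  have h1 := isBigO_sub_of_deriv (F := fun x => Hderiv p β x - Hderiv2 p β m * (x - m))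
    (F' := fun x => Hderiv2 p β x - Hderiv2 p β m) (by
      filter_upwards [hnhds] with x hx
      refine ((hasDerivAt_Hderiv hp β hx).sub
        (((hasDerivAt_id x).sub_const m).const_mul _)).congr_deriv ?_
      ring) h2
  simp only [Hderiv_maximizer hmax, sub_self, mul_zero, sub_zero] at h1
  have h0 := isBigO_sub_of_deriv
    (F := fun x => Hfun p β 0 x - Hderiv2 p β m / 2 * (x - m) ^ 2)
    (F' := fun x => Hderiv p β x - Hderiv2 p β m * (x - m)) (by
      filter_upwards [hnhds] with x hx
      refine ((hasDerivAt_Hfun p β hx).sub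
        ((((hasDerivAt_id x).sub_const m).pow 2).const_mul _)).congr_deriv ?_
      simp only [id]
      push_cast
      ring) h1
  refine h0.congr_left fun x => ?_
  simp only [sub_self]
  ring

lemma gMPL_isBigO {p : ℕ} (hp : 3 ≤ p) {m : ℝ} (hm : m ∈ Set.Ioo (0 : ℝ) 1) :
    (fun x => gMPL p x - gMPL p m - gNum p m / (p * m ^ p) * (x - m))
      =O[𝓝 m] fun x => (x - m) ^ 2 := by
  have hm' : m ∈ Set.Ioo (-1 : ℝ) 1 := ⟨by linarith [hm.1], hm.2⟩
  have hm0 := hm.1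
  have hp0 : (0 : ℝ) < p := by positivity
  have hdiff : DifferentiableAt ℝ (fun x => gNum p x / (p * x ^ p)) m :=
    (hasDerivAt_gNum p hm').differentiableAt.div (by fun_prop) (by positivity)
  have h1 : (fun x => gNum p x / (p * x ^ p) - gNum p m / (p * m ^ p))
      =O[𝓝 m] fun x => (x - m) ^ 1 := by
    simpa using hdiff.isBigO_sub
  have h0 := isBigO_sub_of_deriv
    (F := fun x => gMPL p x - gNum p m / (p * m ^ p) * (x - m))
    (F' := fun x => gNum p x / (p * x ^ p) - gNum p m / (p * m ^ p)) (by
      filter_upwards [isOpen_Ioo.mem_nhds hm] with x hx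
      refine ((hasDerivAt_gMPL hp hx).sub
        (((hasDerivAt_id x).sub_const m).const_mul _)).congr_deriv ?_
      ring) h1
  refine h0.congr_left fun x => ?_
  simp only [sub_self]
  ring

lemma log_one_sub_sq_isBigO {m : ℝ} (hm : m ∈ Set.Ioo (-1 : ℝ) 1) :
    (fun x => log (1 - x ^ 2) - log (1 - m ^ 2)) =O[𝓝 m] fun x => x - m := by
  have h : 1 - m ^ 2 ≠ 0 := by nlinarith [hm.1, hm.2]
  have : DifferentiableAt ℝ (fun x : ℝ => log (1 - x ^ 2)) m := by
    fun_prop (disch := assumption)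
  exact this.isBigO_sub

/-- Uniform Taylor bounds for `Hfun`, `gMPL` and the entropy prefactor on `[m - δ, m + δ]`. -/
structure LocalExpansion (p : ℕ) (β m b γ C δ : ℝ) : Prop where
  m_pos : 0 < m
  b_pos : 0 < b
  γ_pos : 0 < γ
  C_pos : 0 < C
  δ_pos : 0 < δ
  δ_lt : 2 * δ ≤ m
  δ_lt' : 2 * δ ≤ 1 - m
  Cδ_b : C * δ ≤ b / 4
  Cδ_γ : C * δ ≤ γ / 2
  Hfun_sub : ∀ x, |x - m| ≤ δ → |Hfun p β 0 x - Hfun p β 0 m + b * (x - m) ^ 2| ≤ C * |x - m| ^ 3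
  log_sub : ∀ x, |x - m| ≤ δ → |log (1 - x ^ 2) - log (1 - m ^ 2)| ≤ C * |x - m|
  gMPL_sub : ∀ x, |x - m| ≤ δ → |gMPL p x - β - γ * (x - m)| ≤ C * |x - m| ^ 2
  gMPL_mono : StrictMonoOn (gMPL p) (Set.Icc (m - δ) (m + δ))
  gMPL_cont : ContinuousOn (gMPL p) (Set.Icc (m - δ) (m + δ))

lemma exists_localExpansion {p : ℕ} (hp : 3 ≤ p) {β m : ℝ} (hβ : betaStar p < β) (hm : 0 < m)
    (hmax : isMaximizer p β 0 m) :
    ∃ C δ, LocalExpansion p β m (gNum p m / m / 2) (gNum p m / (p * m ^ p)) C δ := by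
  have hk := gNum_maximizer_pos hp hβ hm hmax
  have hm1 := hmax.1.2
  have hp0 : (0 : ℝ) < p := by positivity
  obtain ⟨c1, hc1⟩ := (Hfun_isBigO hp hmax).bound
  obtain ⟨c2, hc2⟩ := (log_one_sub_sq_isBigO hmax.1).bound
  obtain ⟨c3, hc3⟩ := (gMPL_isBigO hp ⟨hm, hm1⟩).bound
  have hpos : ∀ᶠ x in 𝓝 m, 0 < gNum p x :=
    (hasDerivAt_gNum p hmax.1).continuousAt.eventually (lt_mem_nhds hk)
  obtain ⟨ε, hε, hball⟩ :=
    Metric.eventually_nhds_iff_ball.1 (hc1.and (hc2.and (hc3.and hpos)))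
  set b := gNum p m / m / 2 with hb
  set γ := gNum p m / (p * m ^ p) with hγ
  have hb0 : 0 < b := by positivity
  have hγ0 : 0 < γ := by positivity
  set C := |c1| + |c2| + |c3| + 1 with hC
  have hC0 : 0 < C := by positivity
  set δ := min (min (ε / 2) (min (m / 2) ((1 - m) / 2))) (min (b / 4 / C) (γ / 2 / C)) with hδ
  have hδ0 : 0 < δ := by
    have : 0 < 1 - m := by linarith
    simp only [hδ, lt_min_iff]
    refine ⟨⟨?_, ?_, ?_⟩, ?_, ?_⟩ <;> positivity
  have d1 : δ ≤ ε / 2 := (min_le_left _ _).trans (min_le_left _ _)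
  have d2 : δ ≤ m / 2 := (min_le_left _ _).trans ((min_le_right _ _).trans (min_le_left _ _))
  have d3 : δ ≤ (1 - m) / 2 := (min_le_left _ _).trans ((min_le_right _ _).trans (min_le_right _ _))
  have d4 : δ ≤ b / 4 / C := (min_le_right _ _).trans (min_le_left _ _)
  have d5 : δ ≤ γ / 2 / C := (min_le_right _ _).trans (min_le_right _ _)
  have hmem : ∀ x, |x - m| ≤ δ → x ∈ Metric.ball m ε := fun x hx => by
    rw [Metric.mem_ball, Real.dist_eq]; linarith
  have hder : ∀ x ∈ Set.Icc (m - δ) (m + δ), HasDerivAt (gMPL p) (gNum p x / (p * x ^ p)) x :=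
    fun x hx => hasDerivAt_gMPL hp ⟨by linarith [hx.1], by linarith [hx.2]⟩
  have hcont : ContinuousOn (gMPL p) (Set.Icc (m - δ) (m + δ)) :=
    fun x hx => (hder x hx).continuousAt.continuousWithinAt
  have hle1 : c1 ≤ C := by
    linarith [le_abs_self c1, abs_nonneg c2, abs_nonneg c3]
  have hle2 : c2 ≤ C := by
    linarith [le_abs_self c2, abs_nonneg c1, abs_nonneg c3]
  have hle3 : c3 ≤ C := by
    linarith [le_abs_self c3, abs_nonneg c1, abs_nonneg c2]
  refine ⟨C, δ, hm, hb0, hγ0, hC0, hδ0, by linarith, by linarith, ?_, ?_, ?_, ?_, ?_, ?_, hcont⟩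
  · rw [le_div_iff₀ hC0] at d4; linarith
  · rw [le_div_iff₀ hC0] at d5; linarith
  · intro x hx
    have := (hball x (hmem x hx)).1
    have hH2 : Hderiv2 p β m / 2 = -b := by
      have := Hderiv2_maximizer hp hm hmax
      rw [hb]; linarith
    rw [hH2, norm_pow, Real.norm_eq_abs, Real.norm_eq_abs, neg_mul, sub_neg_eq_add] at this
    exact this.trans (by gcongr)
  · intro x hx
    have := (hball x (hmem x hx)).2.1
    rw [Real.norm_eq_abs, Real.norm_eq_abs] at this
    exact this.trans (by gcongr)
  · intro x hx
    have := (hball x (hmem x hx)).2.2.1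
    rw [norm_pow, Real.norm_eq_abs, Real.norm_eq_abs, gMPL_maximizer hp hm hmax] at this
    exact this.trans (by gcongr)
  · refine strictMonoOn_of_hasDerivWithinAt_pos (convex_Icc _ _)
      (f' := fun y => gNum p y / (p * y ^ p)) hcont
      (fun y hy => (hder y (interior_subset hy)).hasDerivWithinAt) ?_
    intro y hy
    have hy' := interior_subset hy
    have hy0 : 0 < y := by linarith [hy'.1]
    have := (hball y (hmem y (by rw [abs_le]; constructor <;> linarith [hy'.1, hy'.2]))).2.2.2
    positivity

lemma cubic_le_exp {b : ℝ} (hb : 0 < b) (y : ℝ) :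
    1 + |y| + |y| ^ 3 ≤ (3 + 64 / b ^ 2) * exp (b / 4 * y ^ 2) := by
  have ht : 0 ≤ b / 4 * y ^ 2 := by positivity
  have hq := quadratic_le_exp_of_nonneg ht
  have h1 : 1 ≤ exp (b / 4 * y ^ 2) := one_le_exp ht
  have hy4 : |y| ^ 4 = y ^ 4 := Even.pow_abs (by decide) y
  have e : y ^ 4 = 32 / b ^ 2 * ((b / 4 * y ^ 2) ^ 2 / 2) := by field_simp; ring
  have h2 : y ^ 4 ≤ 32 / b ^ 2 * exp (b / 4 * y ^ 2) := by
    rw [e]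
    have : 0 ≤ 32 / b ^ 2 := by positivity
    gcongr
    linarith
  have ha := abs_nonneg y
  have h3 : |y| ≤ 1 + |y| ^ 4 := by
    rcases le_or_gt |y| 1 with h | h
    · nlinarith [pow_nonneg ha 4]
    · have := pow_le_pow_right₀ h.le (show 1 ≤ 4 by norm_num)
      rw [pow_one] at this; linarith
  have h4 : |y| ^ 3 ≤ 1 + |y| ^ 4 := by
    rcases le_or_gt |y| 1 with h | h
    · have := pow_le_one₀ (n := 3) ha h
      nlinarith [pow_nonneg ha 4]
    · have := pow_le_pow_right₀ h.le (show 3 ≤ 4 by norm_num)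
      linarith
  have e2 : 64 / b ^ 2 = 2 * (32 / b ^ 2) := by ring
  rw [e2]
  linarith

lemma abs_exp_sub_one_le_mul_exp (u : ℝ) : |exp u - 1| ≤ |u| * exp |u| := by
  have h1 := add_one_le_exp u
  have h2 := add_one_le_exp (-u)
  have hp := exp_pos u
  have hm : exp u * exp (-u) = 1 := by rw [← exp_add]; simp
  rcases le_total 0 u with h | h
  · rw [abs_of_nonneg (by linarith), abs_of_nonneg h]
    nlinarith
  · rw [abs_of_nonpos (by rw [sub_nonpos]; exact exp_le_one_iff.2 h), abs_of_nonpos h]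
    have : 1 ≤ exp (-u) := one_le_exp (by linarith)
    nlinarith

/-- The common prefactor in the local Gaussian approximation of `levelWeight`. -/
def prefactor (p N : ℕ) (β m : ℝ) : ℝ :=
  exp (N * log 2 + N * Hfun p β 0 m + log (2 / (π * N)) / 2 - log (1 - m ^ 2) / 2)

/-- The rescaled deviation of the magnetization from `m`. -/
def dev (N : ℕ) (m x : ℝ) : ℝ := √N * (x - m)

lemma exists_levelWeight_approx {p : ℕ} {β m b γ C δ : ℝ}
    (hL : LocalExpansion p β m b γ C δ) :
    ∃ A, 0 < A ∧ ∀ N k : ℕ, 1 ≤ N → |site N k - m| ≤ δ →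
      |levelWeight p N β k / prefactor p N β m - exp (-b * dev N m (site N k) ^ 2)| ≤
        A / √N * exp (-(b / 2) * dev N m (site N k) ^ 2) := by
  obtain ⟨hm, hb, hγ, hC, hδ, hδm, hδm', hCb, -, hH, hlog, -, -, -⟩ := hL
  have hm1 : 0 < 1 - m := by linarith
  set D := 3 + 4 / (1 - m) with hD
  have hD0 : 0 < D := by positivity
  refine ⟨(C + D) * exp (C + D) * (3 + 64 / b ^ 2), by positivity, fun N k hN hx => ?_⟩
  set x := site N k with hxdef
  have hN0 : (0 : ℝ) < N := by positivity
  have hsN : 0 < √(N : ℝ) := sqrt_pos.2 hN0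
  have hsN1 : 1 ≤ √(N : ℝ) := by rw [one_le_sqrt]; exact_mod_cast hN
  have hsq : √(N : ℝ) * √N = N := mul_self_sqrt hN0.le
  have hxb := abs_le.1 hx
  have hkx : (k : ℝ) = N * (1 + x) / 2 := by rw [hxdef, site]; field_simp; ring
  have hkl : (N : ℝ) / 2 ≤ k := by rw [hkx]; nlinarith
  have hku : (N : ℝ) * (1 - m) / 4 ≤ N - k := by rw [hkx]; nlinarith
  have hku0 : 0 < (N : ℝ) * (1 - m) / 4 := by positivity
  have hk0 : 0 < k := by
    have : (0 : ℝ) < k := by linarith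
    exact_mod_cast this
  have hkN : k < N := by
    have : (k : ℝ) < N := by linarith
    exact_mod_cast this
  have hst := abs_log_levelWeight_sub_le p β hk0 hkN
  rw [← hxdef] at hst
  have herr : 1 / (k : ℝ) + 1 / (N - k : ℝ) + 1 / N ≤ D / √N := by
    have h1 : 1 / (k : ℝ) ≤ 2 / N := by
      rw [div_le_div_iff₀ (by positivity) hN0]; linarith
    have h2 : 1 / (N - k : ℝ) ≤ 4 / (1 - m) / N := by
      rw [div_div, div_le_div_iff₀ (by linarith) (by positivity)]; linarith
    have h3 : D / N ≤ D / √N := by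
      gcongr
      nlinarith
    have h4 : D / N = 2 / N + 4 / (1 - m) / N + 1 / N := by rw [hD]; ring
    linarith
  set y := dev N m x with hy
  have hy2 : y ^ 2 = N * (x - m) ^ 2 := by
    rw [hy, dev, mul_pow, sq_sqrt hN0.le]
  have hyabs : |y| = √N * |x - m| := by rw [hy, dev, abs_mul, abs_of_pos hsN]
  have hw : 0 < levelWeight p N β k := by
    have : (0 : ℝ) < N.choose k := by exact_mod_cast Nat.choose_pos hkN.le
    unfold levelWeight; positivity
  set u := log (levelWeight p N β k) - log (prefactor p N β m) + b * y ^ 2 with hu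
  have hquot : levelWeight p N β k / prefactor p N β m = exp (-b * y ^ 2) * exp u := by
    rw [← exp_add, hu, ← exp_log hw, prefactor, ← exp_sub, log_exp, log_exp]
    congr 1; ring
  have hu3 : |u| ≤ N * (C * |x - m| ^ 3) + C * |x - m| + D / √N := by
    have h1 := hH x hx
    have h2 := hlog x hx
    have e : u = (log (levelWeight p N β k) - (N * log 2 + N * Hfun p β 0 x
        + log (2 / (π * N)) / 2 - log (1 - x ^ 2) / 2))
        + (N * (Hfun p β 0 x - Hfun p β 0 m + b * (x - m) ^ 2)
          + -((log (1 - x ^ 2) - log (1 - m ^ 2)) / 2)) := by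
      rw [hu, hy2, prefactor, log_exp]; ring
    rw [e]
    refine (abs_add_le _ _).trans ?_
    have h3 := abs_add_le (N * (Hfun p β 0 x - Hfun p β 0 m + b * (x - m) ^ 2))
      (-((log (1 - x ^ 2) - log (1 - m ^ 2)) / 2))
    rw [abs_mul, abs_of_pos hN0, abs_neg, abs_div, abs_of_pos (two_pos : (0 : ℝ) < 2)] at h3
    have h4 : (N : ℝ) * |Hfun p β 0 x - Hfun p β 0 m + b * (x - m) ^ 2| ≤
        N * (C * |x - m| ^ 3) := by gcongr
    have h5 := abs_nonneg (log (1 - x ^ 2) - log (1 - m ^ 2))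
    linarith
  have hu1 : |u| ≤ (C + D) / √N * (1 + |y| + |y| ^ 3) := by
    refine hu3.trans ?_
    have e1 : N * (C * |x - m| ^ 3) = C / √N * |y| ^ 3 := by
      rw [hyabs, mul_pow, pow_succ √(N : ℝ) 2, sq_sqrt hN0.le]; field_simp
    have e2 : C * |x - m| = C / √N * |y| := by
      rw [hyabs]; field_simp
    rw [e1, e2]
    have h0 : C / √N ≤ (C + D) / √N := by gcongr; linarith
    have h1 : D / √N ≤ (C + D) / √N := by gcongr; linarith
    have h2 := mul_le_mul_of_nonneg_right h0 (pow_nonneg (abs_nonneg y) 3)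
    have h3 := mul_le_mul_of_nonneg_right h0 (abs_nonneg y)
    linarith
  have hu2 : |u| ≤ b / 4 * y ^ 2 + (C + D) := by
    refine hu3.trans ?_
    have h1 : N * (C * |x - m| ^ 3) ≤ b / 4 * y ^ 2 := by
      have : C * |x - m| ≤ b / 4 := (by gcongr : C * |x - m| ≤ C * δ).trans hCb
      calc N * (C * |x - m| ^ 3) = (C * |x - m|) * (N * |x - m| ^ 2) := by ring
        _ ≤ b / 4 * (N * |x - m| ^ 2) := by gcongr
        _ = b / 4 * y ^ 2 := by rw [hy2, sq_abs]
    have h2 : C * |x - m| ≤ C := by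
      have : |x - m| ≤ 1 := by linarith
      nlinarith
    have h3 : D / √N ≤ D := div_le_self hD0.le hsN1
    linarith
  have hfin := abs_exp_sub_one_le_mul_exp u
  rw [hquot, show exp (-b * y ^ 2) * exp u - exp (-b * y ^ 2) =
    exp (-b * y ^ 2) * (exp u - 1) by ring, abs_mul, abs_of_pos (exp_pos _)]
  calc exp (-b * y ^ 2) * |exp u - 1|
      ≤ exp (-b * y ^ 2) * (((C + D) / √N * (1 + |y| + |y| ^ 3)) *
          exp (b / 4 * y ^ 2 + (C + D))) := by
        gcongr
        refine hfin.trans ?_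
        gcongr
    _ ≤ exp (-b * y ^ 2) * (((C + D) / √N * ((3 + 64 / b ^ 2) * exp (b / 4 * y ^ 2))) *
          exp (b / 4 * y ^ 2 + (C + D))) := by
        gcongr
        exact cubic_le_exp hb y
    _ = (C + D) * exp (C + D) * (3 + 64 / b ^ 2) / √N *
          (exp (-b * y ^ 2) * exp (b / 4 * y ^ 2) * exp (b / 4 * y ^ 2)) := by
        rw [exp_add]; ring
    _ = _ := by
        rw [← exp_add, ← exp_add]
        congr 2
        ring

/-- The total Gibbs weight of the configurations whose magnetization per site lies in `S`. -/
def levelSum (p N : ℕ) (β : ℝ) (S : Set ℝ) : ℝ :=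
  ∑ k ∈ Finset.range (N + 1), S.indicator 1 (site N k) * levelWeight p N β k

lemma levelWeight_nonneg (p N : ℕ) (β : ℝ) (k : ℕ) : 0 ≤ levelWeight p N β k := by
  unfold levelWeight; positivity

lemma levelSum_mono (p N : ℕ) (β : ℝ) {S T : Set ℝ} (h : S ⊆ T) :
    levelSum p N β S ≤ levelSum p N β T := by
  refine Finset.sum_le_sum fun k _ => mul_le_mul_of_nonneg_right ?_ (levelWeight_nonneg p N β k)
  exact Set.indicator_le_indicator_of_subset h (fun _ => zero_le_one) _

lemma levelSum_nonneg (p N : ℕ) (β : ℝ) (S : Set ℝ) : 0 ≤ levelSum p N β S :=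
  Finset.sum_nonneg fun k _ =>
    mul_nonneg (Set.indicator_nonneg (fun _ _ => zero_le_one) _) (levelWeight_nonneg p N β k)

lemma levelSum_union (p N : ℕ) (β : ℝ) {S T : Set ℝ} (h : Disjoint S T) :
    levelSum p N β (S ∪ T) = levelSum p N β S + levelSum p N β T := by
  unfold levelSum
  rw [← Finset.sum_add_distrib]
  refine Finset.sum_congr rfl fun k _ => ?_
  rw [Set.indicator_union_of_disjoint h]
  ring

lemma dev_site_succ {N : ℕ} (hN : 1 ≤ N) (m : ℝ) (k : ℕ) :
    dev N m (site N (k + 1)) = dev N m (site N k) + 2 / √N := by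
  have hN0 : (0 : ℝ) < N := by positivity
  have hsq : √(N : ℝ) * √N = N := mul_self_sqrt hN0.le
  unfold dev site
  push_cast
  have : √(N : ℝ) * (2 / N) = 2 / √N := by
    nth_rw 2 [← hsq]; field_simp
  rw [← this]
  ring

lemma prefactor_pos (p N : ℕ) (β m : ℝ) : 0 < prefactor p N β m := exp_pos _

lemma exists_levelSum_window {p : ℕ} {β m b γ C δ : ℝ} (hL : LocalExpansion p β m b γ C δ) :
    ∃ A, 0 < A ∧ ∀ N : ℕ, 1 ≤ N → ∀ s ∈ Set.Icc (m - δ) (m + δ),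
      |2 / √N * (levelSum p N β (Set.Icc (m - δ) s) / prefactor p N β m)
        - gaussInt b (√N * (s - m))| ≤ A / √N := by
  obtain ⟨A, hA, happrox⟩ := exists_levelWeight_approx hL
  obtain ⟨hm, hb, hγ, hC, hδ, hδm, hδm', -⟩ := hL
  have hb2 : 0 < b / 2 := by positivity
  obtain ⟨M, hM, htail⟩ := exists_gaussInt_tail_le hb
  refine ⟨A * (√(π / (b / 2)) + 4) + 6 + M / δ, by positivity, fun N hN s hs => ?_⟩
  have hN0 : (0 : ℝ) < N := by positivity
  have hsN : 0 < √(N : ℝ) := sqrt_pos.2 hN0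
  have hsN1 : 1 ≤ √(N : ℝ) := by rw [one_le_sqrt]; exact_mod_cast hN
  have hs1 := hs.1
  have hs2 := hs.2
  set h := 2 / √(N : ℝ) with hh
  have hh0 : 0 < h := by positivity
  have hh2 : h ≤ 2 := div_le_self zero_le_two hsN1
  set i := ⌈N * (1 + (m - δ)) / 2⌉₊ with hi
  set j := ⌊N * (1 + s) / 2⌋₊ + 1 with hj
  have hilow : ∀ k : ℕ, m - δ ≤ site N k ↔ i ≤ k := by
    intro k
    rw [hi, Nat.ceil_le, site, le_sub_iff_add_le, le_div_iff₀ hN0, div_le_iff₀ two_pos]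
    constructor <;> intro _ <;> linarith
  have hs0 : 0 ≤ N * (1 + s) / 2 := by
    have : 0 ≤ 1 + s := by linarith
    positivity
  have hjup : ∀ k : ℕ, site N k ≤ s ↔ k < j := by
    intro k
    rw [hj, Nat.lt_succ_iff, Nat.le_floor_iff hs0, site, sub_le_iff_le_add, div_le_iff₀ hN0,
      le_div_iff₀ two_pos]
    constructor <;> intro _ <;> linarith
  have hij : i ≤ j := by
    rw [hi, hj, Nat.ceil_le]
    have := Nat.lt_floor_add_one (N * (1 + s) / 2)
    push_cast
    have h2 : N * (1 + (m - δ)) / 2 ≤ N * (1 + s) / 2 := by gcongr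
    linarith
  have hjN : j ≤ N + 1 := by
    rw [hj]
    refine Nat.succ_le_succ (Nat.floor_le_of_le ?_)
    nlinarith
  have hsum : levelSum p N β (Set.Icc (m - δ) s) = ∑ k ∈ Finset.Ico i j, levelWeight p N β k := by
    have hset : Finset.Ico i j =
        (Finset.range (N + 1)).filter (fun k => i ≤ k ∧ k < j) := by
      ext k
      simp only [Finset.mem_Ico, Finset.mem_filter, Finset.mem_range]
      constructor
      · rintro ⟨h1, h2⟩; exact ⟨by omega, h1, h2⟩
      · exact fun h => h.2
    rw [hset, Finset.sum_filter]
    refine Finset.sum_congr rfl fun k _ => ?_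
    simp only [Set.indicator_apply, Set.mem_Icc, hilow, hjup, Pi.one_apply]
    split_ifs <;> simp
  set Y : ℕ → ℝ := fun k => dev N m (site N k) with hY
  have hYs : ∀ k, Y (k + 1) = Y k + h := dev_site_succ hN m
  have hYj : Y j - h ≤ √N * (s - m) ∧ √N * (s - m) ≤ Y j := by
    constructor
    · have h1 := (hjup ⌊N * (1 + s) / 2⌋₊).2 (Nat.lt_succ_self _)
      rw [hj, hYs, add_sub_cancel_right, hY]
      simp only [dev]
      gcongr
    · have h1 := (hjup j).not.2 (lt_irrefl _)
      push Not at h1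
      simp only [hY, dev]
      gcongr
  have hYi : Y i - h ≤ -(√N * δ) := by
    have h1 : (i : ℝ) < N * (1 + (m - δ)) / 2 + 1 := by
      refine Nat.ceil_lt_add_one ?_
      have : 0 ≤ 1 + (m - δ) := by linarith
      positivity
    have h2 : site N i - m ≤ -δ + 2 / N := by
      have h3 : site N i + 1 = 2 * i / N := by unfold site; ring
      have h4 : 2 * (i : ℝ) / N ≤ 1 + (m - δ) + 2 / N := by
        rw [div_le_iff₀ hN0, add_mul, div_mul_cancel₀ _ hN0.ne']
        linarith
      linarith
    have h5 : √(N : ℝ) * (2 / N) = h := by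
      have hsq : √(N : ℝ) * √N = N := mul_self_sqrt hN0.le
      nth_rw 2 [← hsq]; rw [hh]; field_simp
    have h6 := mul_le_mul_of_nonneg_left h2 hsN.le
    simp only [hY, dev]
    rw [mul_add, h5] at h6
    linarith
  have hR := abs_riemann_sum_sub_gaussInt_le hb hh0 hYs hij
  have hR2 := abs_riemann_sum_sub_gaussInt_le hb2 hh0 hYs hij
  have hEnd : |gaussInt b (√N * (s - m)) - gaussInt b (Y j - h)| ≤ h := by
    refine (abs_gaussInt_sub_le hb (B := 1) fun t _ => ?_).trans ?_
    · rw [exp_le_one_iff]; nlinarith [sq_nonneg t]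
    · rw [one_mul, abs_of_nonneg (by linarith [hYj.1])]
      linarith [hYj.2]
  have hStart : gaussInt b (Y i - h) ≤ M / δ / √N := by
    refine (gaussInt_mono hb hYi).trans ((htail _ (by positivity)).trans (le_of_eq ?_))
    rw [div_div, mul_comm δ]
  have hF : h * ∑ k ∈ Finset.Ico i j, exp (-(b / 2) * Y k ^ 2) ≤ √(π / (b / 2)) + 4 := by
    have h1 := (abs_le.1 hR2).2
    have h2 := gaussInt_le hb2 (Y j - h)
    have h3 := gaussInt_nonneg (b / 2) (Y i - h)
    linarith
  have hDiff : |h * (levelSum p N β (Set.Icc (m - δ) s) / prefactor p N β m)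
      - h * ∑ k ∈ Finset.Ico i j, exp (-b * Y k ^ 2)| ≤ A / √N * (√(π / (b / 2)) + 4) := by
    rw [hsum, Finset.sum_div, ← mul_sub, ← Finset.sum_sub_distrib, abs_mul, abs_of_pos hh0]
    calc h * |∑ k ∈ Finset.Ico i j,
          (levelWeight p N β k / prefactor p N β m - exp (-b * Y k ^ 2))|
        ≤ h * ∑ k ∈ Finset.Ico i j, A / √N * exp (-(b / 2) * Y k ^ 2) := by
          gcongr
          refine (Finset.abs_sum_le_sum_abs _ _).trans (Finset.sum_le_sum fun k hk => ?_)
          have hk' := Finset.mem_Ico.1 hk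
          refine happrox N k hN ?_
          have h1 := (hilow k).2 hk'.1
          have h2 := (hjup k).2 hk'.2
          rw [abs_le]
          constructor <;> linarith
      _ = A / √N * (h * ∑ k ∈ Finset.Ico i j, exp (-(b / 2) * Y k ^ 2)) := by
          rw [← Finset.mul_sum]; ring
      _ ≤ _ := by gcongr
  have hsplit : (A * (√(π / (b / 2)) + 4) + 6 + M / δ) / √N =
      A / √N * (√(π / (b / 2)) + 4) + 3 * h + M / δ / √N := by
    rw [hh]; ring
  have hpos := gaussInt_nonneg b (Y i - h)
  rw [hsplit]
  rw [abs_le] at hR hEnd hDiff ⊢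
  constructor <;> linarith [hR.1, hR.2, hEnd.1, hEnd.2, hDiff.1, hDiff.2]

/-- The values of the magnetization for which the rescaled estimation error is at most `x`. -/
def errorSet (p N : ℕ) (β x : ℝ) : Set ℝ := {t | √N * (gMPL p t - β) ≤ x}

lemma sq_mul_exp_le {b : ℝ} (hb : 0 < b) (y : ℝ) :
    exp (-b * (y / 2) ^ 2) * y ^ 2 ≤ 4 / b := by
  have h1 := add_one_le_exp (b * (y / 2) ^ 2)
  have h2 : exp (-b * (y / 2) ^ 2) * exp (b * (y / 2) ^ 2) = 1 := by
    rw [← exp_add]; simp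
  have h3 := exp_pos (-b * (y / 2) ^ 2)
  rw [le_div_iff₀ hb]
  nlinarith [mul_le_mul_of_nonneg_left h1 h3.le]

lemma exists_levelSum_errorSet {p : ℕ} {β m b γ C δ : ℝ} (hL : LocalExpansion p β m b γ C δ) :
    ∃ A, 0 < A ∧ ∀ N : ℕ, 1 ≤ N → ∀ x : ℝ,
      |2 / √N * (levelSum p N β (errorSet p N β x ∩ Set.Icc (m - δ) (m + δ)) / prefactor p N β m)
        - gaussInt b (x / γ)| ≤ A / √N := by
  obtain ⟨A, hA, hwin⟩ := exists_levelSum_window hL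
  obtain ⟨hm, hb, hγ, hC, hδ, hδm, hδm', -, hCγ, -, -, hg, hmono, hcont⟩ := hL
  obtain ⟨M, hM, htail⟩ := exists_gaussInt_tail_le hb
  refine ⟨A + M / (δ / 2) + C / γ * (4 / b), by positivity, fun N hN x => ?_⟩
  have hN0 : (0 : ℝ) < N := by positivity
  have hsN : 0 < √(N : ℝ) := sqrt_pos.2 hN0
  have hmem : ∀ t, t ∈ errorSet p N β x ↔ gMPL p t ≤ β + x / √N := by
    intro t
    change √N * (gMPL p t - β) ≤ x ↔ _
    rw [← le_div_iff₀' hsN, sub_le_iff_le_add']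
  have hlo : m - δ ∈ Set.Icc (m - δ) (m + δ) := ⟨le_rfl, by linarith⟩
  have hhi : m + δ ∈ Set.Icc (m - δ) (m + δ) := ⟨by linarith, le_rfl⟩
  have hglo := abs_le.1 (hg (m - δ) (by simp [abs_of_pos hδ]))
  have hghi := abs_le.1 (hg (m + δ) (by simp [abs_of_pos hδ]))
  simp only [sub_sub_cancel_left, add_sub_cancel_left, abs_neg, abs_of_pos hδ] at hglo hghi
  have hCδ : C * δ ^ 2 ≤ γ * δ / 2 := by nlinarith
  have hlim : ∀ T, √N * (δ / 2) ≤ T → gaussInt b (-T) ≤ M / (δ / 2) / √N := by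
    intro T hT
    refine (gaussInt_mono hb (neg_le_neg hT)).trans ((htail _ (by positivity)).trans (le_of_eq ?_))
    rw [div_div, mul_comm (δ / 2)]
  have hsplit : (A + M / (δ / 2) + C / γ * (4 / b)) / √N =
      A / √N + M / (δ / 2) / √N + C / γ * (4 / b) / √N := by ring
  have hMp : 0 ≤ M / (δ / 2) / √N := by positivity
  have hCp : 0 ≤ C / γ * (4 / b) / √N := by positivity
  have hAp : 0 ≤ A / √N := by positivity
  rw [hsplit]
  rcases lt_or_ge (β + x / √N) (gMPL p (m - δ)) with hcase | hcase
  · have hempty : errorSet p N β x ∩ Set.Icc (m - δ) (m + δ) = ∅ := by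
      ext t
      simp only [Set.mem_inter_iff, hmem, Set.mem_empty_iff_false, iff_false, not_and]
      intro h1 h2
      have := hmono.monotoneOn hlo h2 h2.1
      linarith
    have hx : √N * (δ / 2) ≤ -(x / γ) := by
      have h1 : x / √N ≤ -(γ * δ / 2) := by linarith
      rw [div_le_iff₀ hsN] at h1
      rw [← neg_div, le_div_iff₀ hγ]
      linarith
    have h2 := hlim _ hx
    rw [neg_neg] at h2
    have h3 := gaussInt_nonneg b (x / γ)
    have h0 : levelSum p N β ∅ = 0 := by simp [levelSum]
    rw [hempty, h0, zero_div, mul_zero, zero_sub, abs_neg, abs_of_nonneg h3]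
    linarith
  rcases le_or_gt (gMPL p (m + δ)) (β + x / √N) with hcase2 | hcase2
  · have hall : errorSet p N β x ∩ Set.Icc (m - δ) (m + δ) = Set.Icc (m - δ) (m + δ) := by
      refine Set.inter_eq_right.2 fun t ht => (hmem t).2 ?_
      exact (hmono.monotoneOn ht hhi ht.2).trans hcase2
    have hx : √N * (δ / 2) ≤ x / γ := by
      have h1 : γ * δ / 2 ≤ x / √N := by linarith
      rw [le_div_iff₀ hsN] at h1
      rw [le_div_iff₀ hγ]
      linarith
    have h1 := abs_le.1 (hwin N hN (m + δ) hhi)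
    rw [add_sub_cancel_left] at h1
    have h2 := hlim _ hx
    have h3 := hlim (√N * δ) (by nlinarith)
    have h4 := gaussInt_add_neg hb (x / γ)
    have h5 := gaussInt_add_neg hb (√N * δ)
    have h6 := gaussInt_nonneg b (-(x / γ))
    have h7 := gaussInt_nonneg b (-(√N * δ))
    rw [hall, abs_le]
    constructor <;> linarith [h1.1, h1.2]
  · obtain ⟨s, hs, hgs⟩ := intermediate_value_Icc (by linarith : m - δ ≤ m + δ) hcont
      ⟨hcase, hcase2.le⟩
    have hset : errorSet p N β x ∩ Set.Icc (m - δ) (m + δ) = Set.Icc (m - δ) s := by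
      ext t
      simp only [Set.mem_inter_iff, hmem, ← hgs]
      constructor
      · rintro ⟨h1, h2⟩
        exact ⟨h2.1, (hmono.le_iff_le h2 hs).1 h1⟩
      · intro h
        have h2 : t ∈ Set.Icc (m - δ) (m + δ) := ⟨h.1, h.2.trans hs.2⟩
        exact ⟨(hmono.le_iff_le h2 hs).2 h.2, h2⟩
    have h1 := abs_le.1 (hwin N hN s hs)
    have hsm : |s - m| ≤ δ := by rw [abs_le]; constructor <;> linarith [hs.1, hs.2]
    have hgs' := hg s hsm
    rw [hgs, add_sub_cancel_left] at hgs'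
    set y := √N * (s - m) with hy
    have hdiff : |x / γ - y| ≤ C / γ * (y ^ 2 / √N) := by
      have e : x / γ - y = √N / γ * (x / √N - γ * (s - m)) := by
        rw [hy]; field_simp
      have e2 : C / γ * (y ^ 2 / √N) = √N / γ * (C * |s - m| ^ 2) := by
        rw [hy, sq_abs, mul_pow]
        field_simp
      rw [e, e2, abs_mul, abs_of_pos (by positivity : 0 < √(N : ℝ) / γ)]
      gcongr
    have hhalf : |x / γ - y| ≤ |y| / 2 := by
      refine hdiff.trans ?_
      have e : C / γ * (y ^ 2 / √N) = (C * |s - m|) * |y| / γ := by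
        have : |y| = √N * |s - m| := by rw [hy, abs_mul, abs_of_pos hsN]
        rw [← sq_abs y, this]
        field_simp
      have h2 : C * |s - m| ≤ γ / 2 := (by gcongr : C * |s - m| ≤ C * δ).trans hCγ
      rw [e, div_le_iff₀ hγ]
      nlinarith [mul_le_mul_of_nonneg_right h2 (abs_nonneg y)]
    have hG : |gaussInt b (x / γ) - gaussInt b y| ≤ C / γ * (4 / b) / √N := by
      refine (abs_gaussInt_sub_le hb (B := exp (-b * (y / 2) ^ 2)) fun t ht => ?_).trans ?_
      · rw [exp_le_exp]
        have h2 : |t - y| ≤ |x / γ - y| := Set.abs_sub_left_of_mem_uIcc ht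
        have h3 : |y| / 2 ≤ |t| := by
          have := abs_sub_abs_le_abs_sub y t
          rw [abs_sub_comm y t] at this
          linarith
        have h4 : (y / 2) ^ 2 ≤ t ^ 2 := by
          rw [sq_le_sq, abs_div, abs_of_pos (two_pos : (0 : ℝ) < 2)]
          exact h3
        nlinarith
      · calc exp (-b * (y / 2) ^ 2) * |x / γ - y|
            ≤ exp (-b * (y / 2) ^ 2) * (C / γ * (y ^ 2 / √N)) := by gcongr
          _ = C / γ * (exp (-b * (y / 2) ^ 2) * y ^ 2) / √N := by ring
          _ ≤ C / γ * (4 / b) / √N := by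
            gcongr
            exact sq_mul_exp_le hb y
    rw [abs_le] at hG
    rw [hset, abs_le]
    constructor <;> linarith [h1.1, h1.2, hG.1, hG.2]

lemma levelSum_neg_preimage {p : ℕ} (hp : Even p) {N : ℕ} (hN : 1 ≤ N) (β : ℝ) (S : Set ℝ) :
    levelSum p N β (Neg.neg ⁻¹' S) = levelSum p N β S := by
  have hN0 : (0 : ℝ) < N := by positivity
  unfold levelSum
  rw [← Finset.sum_range_reflect]
  refine Finset.sum_congr rfl fun k hk => ?_
  have hkN : k ≤ N := Nat.lt_succ_iff.1 (Finset.mem_range.1 hk)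
  have hsite : site N (N - k) = -site N k := by
    unfold site
    rw [Nat.cast_sub hkN]
    field_simp
    ring
  have hweight : levelWeight p N β (N - k) = levelWeight p N β k := by
    unfold levelWeight
    rw [hsite, hp.neg_pow, Nat.choose_symm hkN]
  rw [show N + 1 - 1 - k = N - k by omega, hweight, hsite]
  by_cases h : site N k ∈ S
  · rw [Set.indicator_of_mem h, Set.indicator_of_mem (by simpa using h)]; rfl
  · rw [Set.indicator_of_notMem h, Set.indicator_of_notMem (by simpa using h)]

lemma gMPL_neg {p : ℕ} (hp : Even p) (h0 : p ≠ 0) (t : ℝ) : gMPL p (-t) = gMPL p t := by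
  have hodd : Odd (p - 1) := Nat.Even.sub_odd (Nat.one_le_iff_ne_zero.2 h0) hp odd_one
  have harc : arctanh (-t) = -arctanh t := by
    unfold arctanh
    rw [← mul_neg, ← log_inv, inv_div]
    ring_nf
  unfold gMPL
  rw [harc, hodd.neg_pow, mul_neg, neg_div_neg_eq]

lemma two_pow_mul_exp_le_prefactor (p : ℕ) {N : ℕ} (hN : 1 ≤ N) (β : ℝ) {m : ℝ} (hm : 0 < m)
    (hm1 : m < 1) :
    2 ^ N * exp (N * Hfun p β 0 m) ≤ 2 * √N * prefactor p N β m := by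
  have hN0 : (0 : ℝ) < N := by positivity
  have h2 : (2 : ℝ) ^ N = exp (N * log 2) := by rw [exp_nat_mul, exp_log two_pos]
  have hc : 2 * √(N : ℝ) = exp (log 2 + log N / 2) := by
    rw [exp_add, exp_log two_pos, ← log_sqrt hN0.le, exp_log (sqrt_pos.2 hN0)]
  rw [h2, hc, prefactor, ← exp_add, ← exp_add, exp_le_exp,
    log_div two_ne_zero (by positivity), log_mul pi_ne_zero hN0.ne']
  have h4 : log π ≤ 2 * log 2 := by
    rw [show 2 * log 2 = log 4 by rw [show (4 : ℝ) = 2 ^ 2 by norm_num, log_pow]; norm_num]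
    exact log_le_log pi_pos pi_le_four
  have h5 : log (1 - m ^ 2) ≤ 0 := log_nonpos (by nlinarith) (by nlinarith [sq_nonneg m])
  have h6 : 0 < log 2 := log_pos one_lt_two
  linarith

lemma scaled_levelSum_le_of_gap {p N : ℕ} (hN : 1 ≤ N) {β m η : ℝ} (hm : 0 < m) (hm1 : m < 1)
    (hη : 0 < η) {R : Set ℝ}
    (hR : ∀ x ∈ R, x ∈ Set.Icc (-1 : ℝ) 1 → Hfun p β 0 x ≤ Hfun p β 0 m - η) :
    2 / √N * (levelSum p N β R / prefactor p N β m) ≤ 16 / η ^ 2 / √N := by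
  have hN0 : (0 : ℝ) < N := by positivity
  have hN1 : (1 : ℝ) ≤ N := by exact_mod_cast hN
  have hsN : 0 < √(N : ℝ) := sqrt_pos.2 hN0
  have hK := prefactor_pos p N β m
  have hsum : levelSum p N β R ≤ (N + 1) * (2 * √N * prefactor p N β m * exp (-(N * η))) := by
    have : ∀ k ∈ Finset.range (N + 1), R.indicator 1 (site N k) * levelWeight p N β k ≤
        2 * √N * prefactor p N β m * exp (-(N * η)) := by
      intro k hk
      by_cases hkR : site N k ∈ R
      · rw [Set.indicator_of_mem hkR, Pi.one_apply, one_mul]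
        have hgap := hR _ hkR (site_bounds hk)
        calc levelWeight p N β k
            ≤ 2 ^ N * exp (N * Hfun p β 0 (site N k)) :=
              levelWeight_le p β hN (Nat.lt_succ_iff.1 (Finset.mem_range.1 hk))
          _ ≤ 2 ^ N * exp (N * (Hfun p β 0 m - η)) := by gcongr
          _ = 2 ^ N * exp (N * Hfun p β 0 m) * exp (-(N * η)) := by
              rw [mul_assoc, ← exp_add]; ring_nf
          _ ≤ _ := by
              exact mul_le_mul_of_nonneg_right (two_pow_mul_exp_le_prefactor p hN β hm hm1)
                (exp_pos _).le
      · rw [Set.indicator_of_notMem hkR, zero_mul]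
        positivity
    refine (Finset.sum_le_card_nsmul _ _ _ this).trans (le_of_eq ?_)
    simp
  have hexp : exp (-(N * η)) ≤ 2 / (N * η) ^ 2 := by
    have h1 := quadratic_le_exp_of_nonneg (by positivity : 0 ≤ N * η)
    rw [exp_neg, inv_le_comm₀ (exp_pos _) (by positivity), inv_div]
    nlinarith [mul_pos hN0 hη]
  have hsq : √(N : ℝ) ≤ N := sqrt_le_self_iff.2 (Or.inr hN1)
  calc 2 / √N * (levelSum p N β R / prefactor p N β m)
      ≤ 2 / √N * ((N + 1) * (2 * √N * prefactor p N β m * exp (-(N * η))) / prefactor p N β m) := by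
        gcongr
    _ = 4 * (N + 1) * exp (-(N * η)) := by field_simp; ring
    _ ≤ 4 * (N + N) * (2 / (N * η) ^ 2) := by gcongr
    _ = 16 / η ^ 2 / N := by field_simp; ring
    _ ≤ 16 / η ^ 2 / √N := by gcongr

lemma exists_levelSum_localize {p : ℕ} (hp : 3 ≤ p) {β m δ : ℝ} (hβ : betaStar p < β) (hm : 0 < m)
    (hmax : isMaximizer p β 0 m) (huniq : ∀ m', 0 < m' → isMaximizer p β 0 m' → m' = m)
    (hδ : 0 < δ) (hδm : δ < m) :
    ∃ c A, 0 < c ∧ 0 < A ∧ ∀ N : ℕ, 1 ≤ N → ∀ S : Set ℝ, (Even p → Neg.neg ⁻¹' S = S) →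
      |2 / √N * (levelSum p N β S / prefactor p N β m)
        - c * (2 / √N * (levelSum p N β (S ∩ Set.Icc (m - δ) (m + δ)) / prefactor p N β m))|
        ≤ A / √N := by
  obtain ⟨η, hη, hgap⟩ := exists_Hfun_gap hp hβ hm hmax huniq hδ
  have hm1 : m < 1 := hmax.1.2
  set W := Set.Icc (m - δ) (m + δ) with hW
  have hout : ∀ x, x ∉ W → δ ≤ |x - m| := by
    intro x hx
    by_contra! h
    rw [abs_lt] at h
    exact hx ⟨by linarith, by linarith⟩
  have hrest (N : ℕ) (hN : 1 ≤ N) (R : Set ℝ) (hR : ∀ x ∈ R, x ∉ W ∧ (Even p → -x ∉ W)) :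
      |2 / √N * (levelSum p N β R / prefactor p N β m)| ≤ 16 / η ^ 2 / √N := by
    rw [abs_of_nonneg]
    · refine scaled_levelSum_le_of_gap hN hm hm1 hη fun x hx hx1 =>
        hgap x hx1 (hout x (hR x hx).1) fun he => ?_
      have := hout (-x) ((hR x hx).2 he)
      rwa [← neg_add', abs_neg] at this
    · have := prefactor_pos p N β m
      have := levelSum_nonneg p N β R
      positivity
  by_cases hev : Even p
  · refine ⟨2, 16 / η ^ 2, two_pos, by positivity, fun N hN S hS => ?_⟩
    have hdisj : Disjoint (S ∩ W) (Neg.neg ⁻¹' (S ∩ W)) := by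
      refine Set.disjoint_left.2 fun x hx hx' => ?_
      linarith [hx.2.1, hx'.2.1]
    have hsub : S ∩ W ∪ Neg.neg ⁻¹' (S ∩ W) ⊆ S := by
      rw [Set.preimage_inter, hS hev]
      exact Set.union_subset Set.inter_subset_left Set.inter_subset_left
    have hsum : levelSum p N β S = 2 * levelSum p N β (S ∩ W)
        + levelSum p N β (S \ (S ∩ W ∪ Neg.neg ⁻¹' (S ∩ W))) := by
      conv_lhs => rw [← Set.union_sdiff_cancel hsub]
      rw [levelSum_union _ _ _ Set.disjoint_sdiff_right, levelSum_union _ _ _ hdisj,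
        levelSum_neg_preimage hev hN]
      ring
    refine le_trans (le_of_eq ?_) (hrest N hN (S \ (S ∩ W ∪ Neg.neg ⁻¹' (S ∩ W))) ?_)
    · rw [hsum]
      congr 1
      ring
    · rintro x ⟨hxS, hx⟩
      have hxS' : -x ∈ S := by
        have : x ∈ Neg.neg ⁻¹' S := by rw [hS hev]; exact hxS
        exact this
      exact ⟨fun h => hx (Or.inl ⟨hxS, h⟩), fun _ h => hx (Or.inr ⟨hxS', h⟩)⟩
  · refine ⟨1, 16 / η ^ 2, one_pos, by positivity, fun N hN S _ => ?_⟩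
    have hsum : levelSum p N β S = levelSum p N β (S ∩ W) + levelSum p N β (S \ W) := by
      rw [← levelSum_union _ _ _ Set.disjoint_sdiff_inter.symm, Set.inter_union_sdiff]
    refine le_trans (le_of_eq ?_) (hrest N hN (S \ W) fun x hx => ⟨hx.2, fun h => absurd h hev⟩)
    rw [hsum]
    congr 1
    ring

lemma abs_div_sub_div_le {u v U V ε : ℝ} (hV : 0 < V) (hv : 0 < v) (hu : 0 ≤ u) (huv : u ≤ v)
    (hU : |u - U| ≤ ε) (hVv : |v - V| ≤ ε) : |u / v - U / V| ≤ 2 * ε / V := by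
  have hε : 0 ≤ ε := (abs_nonneg _).trans hU
  have h1 : u / v - U / V = (u / v * (V - v) + (u - U)) / V := by
    field_simp
    ring
  have h2 : |u / v| ≤ 1 := by
    rw [abs_of_nonneg (by positivity)]
    exact (div_le_one hv).2 huv
  rw [h1, abs_div, abs_of_pos hV]
  gcongr
  calc |u / v * (V - v) + (u - U)| ≤ |u / v| * |V - v| + |u - U| := by
        rw [← abs_mul]; exact abs_add_le _ _
    _ ≤ 1 * ε + ε := by
        rw [abs_sub_comm V v]; gcongr
    _ = 2 * ε := by ring

lemma limit_variance_eq {p : ℕ} (hp : 3 ≤ p) {β m : ℝ} (hβ : betaStar p < β) (hm : 0 < m)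
    (hmax : isMaximizer p β 0 m) :
    -(iteratedDeriv 2 (Hfun p β 0) m) / ((p : ℝ) ^ 2 * m ^ (2 * p - 2)) =
      (gNum p m / (p * m ^ p)) ^ 2 / (2 * (gNum p m / m / 2)) := by
  have hg := gNum_maximizer_pos hp hβ hm hmax
  have hp0 : (0 : ℝ) < p := by positivity
  rw [iteratedDeriv_two_Hfun hp β hmax.1, Hderiv2_maximizer hp hm hmax]
  have h1 : (m ^ p) ^ 2 = m ^ (2 * p - 2) * m ^ 2 := by
    rw [← pow_add, ← pow_mul]; congr 1; omega
  rw [div_pow, mul_pow, h1]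
  field_simp

lemma exists_berry_esseen_sqrt {p : ℕ} (hp : 3 ≤ p) {β m : ℝ} (hβ : betaStar p < β)
    (hm : 0 < m) (hmax : isMaximizer p β 0 m)
    (huniq : ∀ m', 0 < m' → isMaximizer p β 0 m' → m' = m) :
    ∃ A, 0 < A ∧ ∀ N : ℕ, 1 ≤ N → ∀ x : ℝ,
      |cwProb p N β 0 {σ | mag σ / N ∈ errorSet p N β x} -
        gaussCDF (-(iteratedDeriv 2 (Hfun p β 0) m) / ((p : ℝ) ^ 2 * m ^ (2 * p - 2))) x|
        ≤ A / √N := by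
  obtain ⟨C, δ, hL⟩ := exists_localExpansion hp hβ hm hmax
  rw [limit_variance_eq hp hβ hm hmax]
  set b := gNum p m / m / 2
  set γ := gNum p m / (p * m ^ p)
  have hb := hL.b_pos
  have hδ := hL.δ_pos
  obtain ⟨c, A₁, hc, hA₁, hloc⟩ := exists_levelSum_localize hp hβ hm hmax huniq hδ
    (by linarith [hL.δ_lt])
  obtain ⟨A₂, hA₂, herr⟩ := exists_levelSum_errorSet hL
  obtain ⟨A₃, hA₃, hwin⟩ := exists_levelSum_window hL
  obtain ⟨M, hM, htail⟩ := exists_gaussInt_tail_le hb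
  set V := √(π / b)
  have hV : 0 < V := by positivity
  set ε := A₁ + c * (A₂ + A₃ + M / δ)
  refine ⟨2 * ε / (c * V), by positivity, fun N hN x => ?_⟩
  have hN0 : (0 : ℝ) < N := by positivity
  have hsN : 0 < √(N : ℝ) := sqrt_pos.2 hN0
  have hK := prefactor_pos p N β m
  set scaled : Set ℝ → ℝ := fun S => 2 / √N * (levelSum p N β S / prefactor p N β m) with hscaled
  have hcomb {S : Set ℝ} {G : ℝ} (hS : Even p → Neg.neg ⁻¹' S = S)
      (hG : |scaled (S ∩ Set.Icc (m - δ) (m + δ)) - G| ≤ (A₂ + A₃ + M / δ) / √N) :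
      |scaled S - c * G| ≤ ε / √N := by
    have h1 := abs_le.1 (hloc N hN S hS)
    have h2 := mul_le_mul_of_nonneg_left hG hc.le
    rw [← abs_of_pos hc, ← abs_mul, abs_of_pos hc, abs_le] at h2
    have e : ε / √N = A₁ / √N + c * ((A₂ + A₃ + M / δ) / √N) := by ring
    rw [e, abs_le]
    constructor <;> linarith [h1.1, h1.2, h2.1, h2.2]
  have hAdd : (A₂ + A₃ + M / δ) / √N = A₂ / √N + A₃ / √N + M / δ / √N := by ring
  have hp1 : 0 < A₂ / √N := by positivity
  have hp2 : 0 < A₃ / √N := by positivity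
  have hp3 : 0 < M / δ / √N := by positivity
  have hU : |scaled (errorSet p N β x) - c * gaussInt b (x / γ)| ≤ ε / √N := by
    refine hcomb (fun hev => ?_) ((herr N hN x).trans (by linarith))
    ext t
    simp only [errorSet, Set.mem_preimage, Set.mem_ofPred_eq, gMPL_neg hev (by omega)]
  have hT : |scaled Set.univ - c * V| ≤ ε / √N := by
    refine hcomb (fun _ => rfl) ?_
    have h1 := abs_le.1 (hwin N hN (m + δ) ⟨by linarith, le_rfl⟩)
    rw [add_sub_cancel_left] at h1
    have h2 := htail (√N * δ) (by positivity)
    rw [mul_comm (√(N : ℝ)) δ, ← div_div, mul_comm δ] at h2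
    have h3 := gaussInt_add_neg hb (√N * δ)
    have h4 := gaussInt_nonneg b (-(√N * δ))
    rw [Set.univ_inter, abs_le, hAdd]
    constructor <;> linarith [h1.1, h1.2]
  have htot : 0 < levelSum p N β Set.univ := by
    unfold levelSum levelWeight
    refine Finset.sum_pos (fun k hk => ?_) ⟨0, by simp⟩
    have := Nat.choose_pos (Nat.lt_succ_iff.1 (Finset.mem_range.1 hk))
    rw [Set.indicator_univ, Pi.one_apply]
    positivity
  have hprob : cwProb p N β 0 {σ | mag σ / N ∈ errorSet p N β x} =
      scaled (errorSet p N β x) / scaled Set.univ := by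
    have htot' : levelSum p N β Set.univ = ∑ k ∈ Finset.range (N + 1), levelWeight p N β k := by
      simp [levelSum]
    rw [cwProb_eq p N hN, ← htot']
    change levelSum p N β _ / _ = _
    simp only [hscaled]
    field_simp
  rw [hprob, gaussCDF_eq hb hL.γ_pos, ← mul_div_mul_left _ V hc.ne']
  refine (abs_div_sub_div_le (by positivity) (by positivity) ?_ ?_ hU hT).trans (le_of_eq ?_)
  · have := levelSum_nonneg p N β (errorSet p N β x)
    positivity
  · have := levelSum_mono p N β (Set.subset_univ (errorSet p N β x))
    simp only [hscaled]
    gcongr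
  · ring

/-- **Berry–Esseen bound for the maximum pseudolikelihood estimate of `β`.** -/
theorem berry_esseen_mple
    (p : ℕ) (hp : 3 ≤ p) (β m : ℝ) (hβ : betaStar p < β)
    (hm : 0 < m) (hmax : isMaximizer p β 0 m)
    (huniq : ∀ m', 0 < m' → isMaximizer p β 0 m' → m' = m) :
    ∃ C : ℝ, 0 < C ∧
      ∀ N : ℕ, 2 ≤ N → ∀ x : ℝ,
        |cwProb p N β 0
            {σ | Real.sqrt N * (gMPL p (mag σ / N) - β) ≤ x} -
          gaussCDF (-(iteratedDeriv 2 (Hfun p β 0) m) / ((p : ℝ)^2 * m ^ (2*p - 2))) x|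
          ≤ C * Real.log N / Real.sqrt N := by
  obtain ⟨A, hA, h⟩ := exists_berry_esseen_sqrt hp hβ hm hmax huniq
  have h2 : 0 < log 2 := log_pos one_lt_two
  refine ⟨A / log 2, by positivity, fun N hN x => (h N (by omega) x).trans ?_⟩
  gcongr
  have hlog : log 2 ≤ log N := log_le_log two_pos (by exact_mod_cast hN)
  rw [div_mul_eq_mul_div, le_div_iff₀ h2]
  gcongr
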